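/- Fix i ≥ 1 and, for each n ≥ i, let f be the literal function (x_1,…,x_n) ↦ x_i. Then P_n(f) = Θ(1/n²) as n → ∞: there exist constants 0 < c₁ ≤ c₂ and an integer N such that c₁/n² ≤ P_n(f) ≤ c₂/n² for all n ≥ N. -/

import Mathlib

/-- An and/or tree skeleton: leaves carry a variable index and a polarity
(`true` = positive literal, `false` = negated literal); internal nodes carry
a connective (`true` = AND, `false` = OR) and a list of children. -/
inductive AT (n : ℕ) : Type
  | leaf : Fin n → Bool → AT n
  | node : Bool → List (AT n) → AT n

namespace AT

/-- The connective at the root, if the root is an internal node. -/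
def rootConn {n : ℕ} : AT n → Option Bool
  | .leaf _ _ => none
  | .node c _ => some c

/-- Whether a tree is a single leaf. -/
def isLeafB {n : ℕ} : AT n → Bool
  | .leaf _ _ => true
  | .node _ _ => false

/-- The children of the root. -/
def rootChildren {n : ℕ} : AT n → List (AT n)
  | .leaf _ _ => []
  | .node _ ts => ts

/-- Well-formedness: an associative tree is a plane tree in which each internal
node has at least two children, no internal node has the same connective as its
parent (stratification), and leaves carry literals. -/
inductive WF {n : ℕ} : AT n → Prop
  | leaf (i : Fin n) (b : Bool) : WF (.leaf i b)
  | node (c : Bool) (ts : List (AT n)) :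
      2 ≤ ts.length → (∀ t ∈ ts, WF t) → (∀ t ∈ ts, rootConn t ≠ some c) →
      WF (.node c ts)

mutual
/-- The size of a tree: its total number of nodes. -/
def size {n : ℕ} : AT n → ℕ
  | .leaf _ _ => 1
  | .node _ ts => 1 + sizeList ts
def sizeList {n : ℕ} : List (AT n) → ℕ
  | [] => 0
  | t :: ts => size t + sizeList ts
end

mutual
/-- The Boolean function computed by a tree. -/
def eval {n : ℕ} : AT n → (Fin n → Bool) → Bool
  | .leaf i b, x => if b then x i else ! x i
  | .node c ts, x => evalList c ts x
def evalList {n : ℕ} : Bool → List (AT n) → (Fin n → Bool) → Bool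
  | c, [], _ => c
  | c, t :: ts, x => if c then eval t x && evalList c ts x
                     else eval t x || evalList c ts x
end

end AT

open AT

/-- Number of associative trees of size `m` in a family `𝒯`. -/
noncomputable def countIn (n : ℕ) (𝒯 : Set (AT n)) (m : ℕ) : ℕ :=
  Nat.card {t : AT n // t ∈ 𝒯 ∧ WF t ∧ size t = m}

/-- `A n m` is the number of associative trees of size `m` on `n` variables. -/
noncomputable def A (n m : ℕ) : ℕ := countIn n Set.univ m

/-- `Pmn n m f` is the proportion, among associative trees of size `m` on `n`
variables, of those computing the Boolean function `f`. -/
noncomputable def Pmn (n m : ℕ) (f : (Fin n → Bool) → Bool) : ℝ :=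
  (countIn n {t | eval t = f} m : ℝ) / (A n m : ℝ)

/-- Ratio of trees of size `m` in the family `𝒯` among all trees of size `m`. -/
noncomputable def ratio (n : ℕ) (𝒯 : Set (AT n)) (m : ℕ) : ℝ :=
  (countIn n 𝒯 m : ℝ) / (A n m : ℝ)

/-- `HasLimRatio n 𝒯 μ` : the limiting ratio of the family `𝒯` exists and is `μ`. -/
def HasLimRatio (n : ℕ) (𝒯 : Set (AT n)) (μ : ℝ) : Prop :=
  Filter.Tendsto (ratio n 𝒯) Filter.atTop (nhds μ)

/-- Extension of a Boolean function of `n₀` variables to `n ≥ n₀` variables. -/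
def extend {n₀ n : ℕ} (h : n₀ ≤ n) (f : (Fin n₀ → Bool) → Bool) :
    (Fin n → Bool) → Bool :=
  fun x => f (fun j => x (Fin.castLE h j))

open Classical in
/-- The tree size complexity of a Boolean function. -/
noncomputable def Lcomp (n : ℕ) (f : (Fin n → Bool) → Bool) : ℕ :=
  if f = (fun _ => true) ∨ f = (fun _ => false) then 0
  else if ∃ i : Fin n, f = (fun x => x i) ∨ f = (fun x => ! x i) then 2
  else sInf {m | ∃ t : AT n, WF t ∧ size t = m ∧ eval t = f}



/-! ### NOR trees -/

inductive NT (n : ℕ) : Type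
  | leaf : Fin n → Bool → NT n
  | node : NT n → NT n → List (NT n) → NT n

namespace NT

variable {n : ℕ}

def sz : NT n → ℕ
  | leaf _ _ => 1
  | node a b l => 1 + (sz a + (sz b + (l.map sz).sum))

def ev : NT n → (Fin n → Bool) → Bool
  | leaf i b => fun x => x i == b
  | node a b l => fun x => !ev a x && (!ev b x && (l.map ev).all (fun f => !f x))

def mk : (l : List (NT n)) → 2 ≤ l.length → NT n
  | a :: b :: l, _ => node a b l
  | [], h => absurd h (by simp)
  | [_], h => absurd h (by simp)

/-- total size of a list -/
def tot (l : List (NT n)) : ℕ := (l.map sz).sum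

/-- nor of a list -/
def nor (l : List (NT n)) (x : Fin n → Bool) : Bool := l.all (fun t => !ev t x)

@[simp] lemma tot_nil : tot ([] : List (NT n)) = 0 := rfl
@[simp] lemma tot_cons (t : NT n) (l) : tot (t :: l) = sz t + tot l := by simp [tot]
@[simp] lemma tot_append (l l' : List (NT n)) : tot (l ++ l') = tot l + tot l' := by simp [tot]
@[simp] lemma sz_leaf (i : Fin n) (b) : sz (leaf i b) = 1 := by simp [sz]
@[simp] lemma ev_leaf (i : Fin n) (b x) : ev (leaf i b) x = (x i == b) := by simp [ev]

lemma sz_mk (l : List (NT n)) (h) : sz (mk l h) = 1 + tot l := by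
  match l, h with
  | a :: b :: l, _ => simp [mk, sz, tot]
  | [], h => simp at h
  | [_], h => simp at h

lemma ev_mk (l : List (NT n)) (h) : ev (mk l h) = nor l := by
  funext x
  match l, h with
  | a :: b :: l, _ => simp [mk, ev, nor, Function.comp_def]
  | [], h => simp at h
  | [_], h => simp at h

lemma sz_pos (t : NT n) : 1 ≤ sz t := by
  cases t <;> simp [sz]

def eqv : NT n ≃ (Fin n × Bool) ⊕ {l : List (NT n) // 2 ≤ l.length} where
  toFun
    | leaf i b => Sum.inl (i, b)
    | node a b l => Sum.inr ⟨a :: b :: l, by simp⟩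
  invFun
    | Sum.inl p => leaf p.1 p.2
    | Sum.inr l => mk l.1 l.2
  left_inv t := by cases t <;> simp [mk]
  right_inv p := by
    rcases p with p | ⟨l, h⟩
    · rfl
    · match l, h with
      | a :: b :: l, _ => simp [mk]
      | [], h => simp at h
      | [_], h => simp at h

@[elab_as_elim]
lemma ind {P : NT n → Prop} (hl : ∀ i b, P (leaf i b))
    (hn : ∀ l h, (∀ t ∈ l, P t) → P (mk l h)) (t : NT n) : P t := by
  match t with
  | leaf i b => exact hl i b
  | node a b l =>
    have := hn (a :: b :: l) (by simp) (by
      intro t ht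
      have hlt : sizeOf t < sizeOf (node a b l) := by
        simp only [List.mem_cons] at ht
        rcases ht with rfl | rfl | ht
        · simp; omega
        · simp; omega
        · have := List.sizeOf_lt_of_mem ht
          simp; omega
      exact ind hl hn t)
    simpa [mk] using this
termination_by sizeOf t
decreasing_by exact hlt

open scoped ENNReal

lemma tsum_NT (f : NT n → ℝ≥0∞) :
    ∑' t, f t = ∑ p : Fin n × Bool, f (leaf p.1 p.2) +
      ∑' l : {l : List (NT n) // 2 ≤ l.length}, f (mk l.1 l.2) := by
  rw [← eqv.symm.tsum_eq, Summable.tsum_sum ENNReal.summable ENNReal.summable, tsum_fintype]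
  rfl

lemma tsum_list {α : Type*} (f : List α → ℝ≥0∞) :
    ∑' l, f l = f [] + ∑' t, ∑' l, f (t :: l) := by
  let e : List α ≃ Unit ⊕ (α × List α) :=
    { toFun := fun l => match l with
        | [] => Sum.inl ()
        | a :: l => Sum.inr (a, l)
      invFun := fun p => match p with
        | Sum.inl _ => []
        | Sum.inr p => p.1 :: p.2
      left_inv := fun l => by cases l <;> rfl
      right_inv := fun p => by rcases p with p | p <;> rfl }
  rw [← e.symm.tsum_eq, Summable.tsum_sum ENNReal.summable ENNReal.summable, tsum_fintype]
  simp [e, ← ENNReal.tsum_prod]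

lemma tsum_list_len {α : Type*} (φ : α → ℝ≥0∞) (k : ℕ) :
    ∑' l : List α, (if l.length = k then (l.map φ).prod else 0) = (∑' a, φ a) ^ k := by
  induction k with
  | zero => rw [tsum_list]; simp
  | succ k ih =>
    rw [tsum_list, pow_succ', ← ih, ← ENNReal.tsum_mul_right]
    simp [← ENNReal.tsum_mul_left]

lemma tsum_list_prod {α : Type*} (φ : α → ℝ≥0∞) :
    ∑' l : List α, (l.map φ).prod = (1 - ∑' a, φ a)⁻¹ := by
  rw [← ENNReal.tsum_geometric]
  simp_rw [← tsum_list_len]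
  rw [ENNReal.tsum_comm]
  simp

lemma tsum_list_two {α : Type*} (f : List α → ℝ≥0∞) :
    ∑' l, f l = f [] + ∑' t, f [t] + ∑' l : {l : List α // 2 ≤ l.length}, f l.1 := by
  have hs : ∑' l : {l : List α // 2 ≤ l.length}, f l.1 = _ :=
    tsum_subtype {l : List α | 2 ≤ l.length} f
  rw [hs, tsum_list]
  conv_rhs => rw [tsum_list]
  simp only [Set.indicator, Set.mem_ofPred_eq, add_assoc]
  congr 1
  have h0 : ¬ (2 ≤ 0) := by omega
  simp only [List.length_nil, h0, if_false, zero_add, List.length_cons]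
  rw [← ENNReal.tsum_add]
  congr 1; ext t
  rw [tsum_list]
  conv_rhs => rw [tsum_list]
  simp

end NT

/-! ### Link between associative trees and NOR trees -/

lemma AT.sizeList_eq {n : ℕ} (l : List (AT n)) : AT.sizeList l = (l.map AT.size).sum := by
  induction l with
  | nil => simp [AT.sizeList]
  | cons a l ih => simp [AT.sizeList, ih]

lemma AT.evalList_true {n : ℕ} (l : List (AT n)) (x) :
    AT.evalList true l x = l.all (fun t => AT.eval t x) := by
  induction l with
  | nil => simp [AT.evalList]
  | cons a l ih => simp [AT.evalList, ih]

lemma AT.evalList_false {n : ℕ} (l : List (AT n)) (x) :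
    AT.evalList false l x = l.any (fun t => AT.eval t x) := by
  induction l with
  | nil => simp [AT.evalList]
  | cons a l ih => simp [AT.evalList, ih]

lemma list_map_inj_of {α β : Type*} (f : α → β) (l l' : List α)
    (h : ∀ t ∈ l, ∀ t', f t = f t' → t = t') (hm : l.map f = l'.map f) : l = l' := by
  induction l generalizing l' with
  | nil => simpa using hm
  | cons a l ih =>
    cases l' with
    | nil => simp at hm
    | cons a' l' =>
      simp only [List.map_cons, List.cons.injEq] at hm
      rw [h a (by simp) a' hm.1, ih l' (fun t ht => h t (by simp [ht])) hm.2]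

lemma list_map_surj_of {α β : Type*} (f : α → β) (l : List β)
    (h : ∀ t ∈ l, ∃ a, f a = t) : ∃ l' : List α, l'.map f = l := by
  induction l with
  | nil => exact ⟨[], rfl⟩
  | cons a l ih =>
    obtain ⟨l', rfl⟩ := ih (fun t ht => h t (by simp [ht]))
    obtain ⟨b, rfl⟩ := h a (by simp)
    exact ⟨b :: l', rfl⟩

namespace NT

variable {n : ℕ}

def toAT : NT n → Bool → AT n
  | leaf i b => fun c => AT.leaf i (b == c)
  | node a b l => fun c => AT.node c (toAT a (!c) :: toAT b (!c) :: (l.map toAT).map (fun f => f (!c)))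

lemma toAT_leaf (i : Fin n) (b c) : toAT (leaf i b) c = AT.leaf i (b == c) := by simp [toAT]

lemma toAT_mk (l : List (NT n)) (h) (c) :
    toAT (mk l h) c = AT.node c (l.map (fun t => toAT t (!c))) := by
  match l, h with
  | a :: b :: l, _ => simp [mk, toAT, Function.comp_def]
  | [], h => simp at h
  | [_], h => simp at h

lemma size_toAT (t : NT n) : ∀ c, AT.size (toAT t c) = sz t := by
  induction t using ind with
  | hl i b => intro c; simp [toAT_leaf, AT.size]
  | hn l h ih =>
    intro c
    rw [toAT_mk, sz_mk, AT.size, AT.sizeList_eq, tot, List.map_map]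
    congr 2
    apply List.map_congr_left
    intro t ht
    exact ih t ht _

lemma eval_toAT (t : NT n) : ∀ c x, AT.eval (toAT t c) x = (ev t x == c) := by
  induction t using ind with
  | hl i b => intro c x; simp [toAT_leaf, AT.eval]; cases b <;> cases c <;> cases x i <;> rfl
  | hn l h ih =>
    intro c x
    rw [toAT_mk, ev_mk, AT.eval, nor]
    cases c
    · rw [AT.evalList_false, List.any_map]
      simp only [beq_false, List.not_all_eq_any_not, Bool.not_not]
      rw [Bool.eq_iff_iff]
      simp only [List.any_eq_true, Function.comp]
      exact exists_congr fun t => and_congr_right fun ht => by rw [ih t ht]; simp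
    · rw [AT.evalList_true, List.all_map]
      rw [Bool.eq_iff_iff]
      simp only [beq_true, List.all_eq_true, Function.comp]
      exact forall₂_congr fun t ht => by rw [ih t ht]; simp

lemma wf_toAT (t : NT n) : ∀ c, AT.WF (toAT t c) ∧ AT.rootConn (toAT t c) ≠ some (!c) := by
  induction t using ind with
  | hl i b => intro c; simp [toAT_leaf, AT.rootConn, AT.WF.leaf]
  | hn l h ih =>
    intro c
    rw [toAT_mk]
    refine ⟨AT.WF.node _ _ (by simpa using h) ?_ ?_, by simp [AT.rootConn]⟩
    · intro t ht
      simp only [List.mem_map] at ht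
      obtain ⟨t, ht, rfl⟩ := ht
      exact (ih t ht _).1
    · intro t ht
      simp only [List.mem_map] at ht
      obtain ⟨t, ht, rfl⟩ := ht
      simpa using (ih t ht (!c)).2

lemma toAT_inj (t : NT n) : ∀ c t', toAT t c = toAT t' c → t = t' := by
  induction t using ind with
  | hl i b =>
    intro c t' h
    cases t' using ind with
    | hl i' b' =>
      simp only [toAT_leaf, AT.leaf.injEq] at h
      obtain ⟨rfl, h⟩ := h
      congr 1
      revert h; cases b <;> cases b' <;> cases c <;> simp
    | hn l' h' => simp [toAT_leaf, toAT_mk] at h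
  | hn l hl ih =>
    intro c t' h
    cases t' using ind with
    | hl i' b' => simp [toAT_leaf, toAT_mk] at h
    | hn l' h' =>
      simp only [toAT_mk, AT.node.injEq, true_and] at h
      have := list_map_inj_of _ l l' (fun t ht t' => ih t ht _ t') h
      subst this
      rfl

lemma toAT_surj (a : AT n) (h : AT.WF a) : ∀ c, AT.rootConn a ≠ some (!c) → ∃ t, toAT t c = a := by
  induction h with
  | leaf i b =>
    intro c _
    refine ⟨leaf i (b == c), ?_⟩
    rw [toAT_leaf]
    cases b <;> cases c <;> rfl
  | node c' ts hl _ hr ih =>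
    intro c hc
    have hcc : c' = c := by
      simp only [AT.rootConn] at hc
      revert hc; cases c <;> cases c' <;> simp
    subst hcc
    obtain ⟨l, hl'⟩ := list_map_surj_of (fun t : NT n => toAT t (!c')) ts
      (fun t ht => ih t ht _ (by simpa using hr t ht))
    subst hl'
    exact ⟨mk l (by simpa using hl), toAT_mk _ _ _⟩

lemma countIn_gen (T : Set (AT n)) (m : ℕ) (hm : 2 ≤ m)
    (hfin : Finite {t : NT n // sz t = m}) :
    countIn n T m = Nat.card {t : NT n // toAT t true ∈ T ∧ sz t = m} +
      Nat.card {t : NT n // toAT t false ∈ T ∧ sz t = m} := by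
  have hf1 : ∀ c, Finite {t : NT n // toAT t c ∈ T ∧ sz t = m} := fun c =>
    Finite.of_injective (fun t => (⟨t.1, t.2.2⟩ : {t : NT n // sz t = m}))
      (fun t t' h => by simpa [Subtype.ext_iff] using h)
  have := hf1 true
  have := hf1 false
  rw [← Nat.card_sum, countIn]
  symm
  let F : {t : NT n // toAT t true ∈ T ∧ sz t = m} ⊕ {t : NT n // toAT t false ∈ T ∧ sz t = m} →
      {t : AT n // t ∈ T ∧ AT.WF t ∧ AT.size t = m} :=
    Sum.elim (fun t => ⟨toAT t.1 true, t.2.1, (wf_toAT _ _).1, by rw [size_toAT, t.2.2]⟩)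
      (fun t => ⟨toAT t.1 false, t.2.1, (wf_toAT _ _).1, by rw [size_toAT, t.2.2]⟩)
  have key : ∀ t : NT n, sz t = m → ∀ c, AT.rootConn (toAT t c) = some c := by
    intro t ht c
    cases t using ind with
    | hl i b => simp at ht; omega
    | hn l h => simp [toAT_mk, AT.rootConn]
  apply Nat.card_eq_of_bijective F
  constructor
  · rintro (⟨t, ht⟩ | ⟨t, ht⟩) (⟨t', ht'⟩ | ⟨t', ht'⟩) h <;>
      simp only [F, Sum.elim_inl, Sum.elim_inr, Subtype.mk.injEq] at h
    · have := toAT_inj _ _ _ h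
      subst this; rfl
    · have := congrArg AT.rootConn h
      rw [key _ ht.2, key _ ht'.2] at this
      simp at this
    · have := congrArg AT.rootConn h
      rw [key _ ht.2, key _ ht'.2] at this
      simp at this
    · have := toAT_inj _ _ _ h
      subst this; rfl
  · rintro ⟨a, ha, hw, hs⟩
    by_cases hc : AT.rootConn a = some false
    · obtain ⟨t, rfl⟩ := toAT_surj a hw false (by simp [hc])
      exact ⟨Sum.inr ⟨t, ha, by rw [← hs, size_toAT]⟩, rfl⟩
    · obtain ⟨t, rfl⟩ := toAT_surj a hw true (by simpa using hc)
      exact ⟨Sum.inl ⟨t, ha, by rw [← hs, size_toAT]⟩, rfl⟩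

end NT

/-! ### Ratio limit lemmas -/

section RatioLemmas
open Filter Topology

lemma tendsto_zero_of_contr (e η : ℕ → ℝ) (θ : ℝ) (h0 : 0 ≤ θ) (h1 : θ < 1)
    (he : ∀ k, 0 ≤ e k) (hη : Tendsto η atTop (𝓝 0))
    (h : ∀ k, e (k + 1) ≤ θ * e k + η k) : Tendsto e atTop (𝓝 0) := by
  rw [Metric.tendsto_atTop]
  intro ε hε
  have hc : 0 < (1 - θ) * (ε / 2) := mul_pos (by linarith) (by linarith)
  obtain ⟨K, hK⟩ := (Metric.tendsto_atTop.1 hη) _ hc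
  have step : ∀ j, e (K + j) ≤ θ ^ j * e K + ε / 2 := by
    intro j
    induction j with
    | zero => simp; linarith
    | succ j ih =>
      have h2 := h (K + j)
      have h3 := hK (K + j) (by omega)
      rw [Real.dist_eq, sub_zero] at h3
      have h4 := (abs_lt.1 h3).2
      have h5 : θ * e (K + j) ≤ θ * (θ ^ j * e K + ε / 2) := mul_le_mul_of_nonneg_left ih h0
      rw [← add_assoc, pow_succ]
      nlinarith
  have hp : Tendsto (fun j => θ ^ j * e K) atTop (𝓝 0) := by
    simpa using (tendsto_pow_atTop_nhds_zero_of_lt_one h0 h1).mul_const (e K)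
  obtain ⟨J, hJ⟩ := (Metric.tendsto_atTop.1 hp) (ε / 2) (by linarith)
  refine ⟨K + J, fun m hm => ?_⟩
  obtain ⟨j, rfl⟩ := Nat.exists_eq_add_of_le (show K ≤ m by omega)
  have h2 := hJ j (by omega)
  rw [Real.dist_eq, sub_zero] at h2 ⊢
  have h3 := (abs_lt.1 h2).2
  rw [abs_of_nonneg (he _)]
  have := step j
  linarith

lemma tendsto_of_contr (x η : ℕ → ℝ) (c θ : ℝ) (h0 : 0 ≤ θ) (h1 : θ < 1)
    (hη : Tendsto η atTop (𝓝 0))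
    (h : ∀ k, |x (k + 1) - c| ≤ θ * |x k - c| + |η k|) : Tendsto x atTop (𝓝 c) := by
  have := tendsto_zero_of_contr (fun k => |x k - c|) (fun k => |η k|) θ h0 h1
    (fun k => abs_nonneg _) (by simpa using hη.abs) h
  rw [tendsto_iff_dist_tendsto_zero]
  simpa [Real.dist_eq] using this

lemma b_growth (n : ℕ) (hn : 3 ≤ n) (b : ℕ → ℝ) (b0 : 0 < b 0) (b1 : b 1 = 2 * n * b 0)
    (hrec : ∀ k : ℕ, (k + 4) * b (k + 2) =
      2 * n * (2 * k + 5) * b (k + 1) - (4 * n ^ 2 - 8 * n) * (k + 1) * b k) :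
    ∀ k, 0 < b k ∧ 2 * n * b k ≤ b (k + 1) := by
  have hn' : (3 : ℝ) ≤ n := by exact_mod_cast hn
  intro k
  induction k with
  | zero => exact ⟨b0, b1.ge⟩
  | succ k ih =>
    obtain ⟨h1, h2⟩ := ih
    have hp : 0 < b (k + 1) := lt_of_lt_of_le (by positivity) h2
    refine ⟨hp, ?_⟩
    have hk : (0 : ℝ) ≤ k := Nat.cast_nonneg k
    have h3 : (4 * (n : ℝ) ^ 2 - 8 * n) * (k + 1) * b k ≤ (2 * n - 4) * (k + 1) * b (k + 1) := by
      have : (4 * (n : ℝ) ^ 2 - 8 * n) * (k + 1) * b k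
          = (2 * n - 4) * (k + 1) * (2 * n * b k) := by ring
      rw [this]
      exact mul_le_mul_of_nonneg_left h2 (mul_nonneg (by linarith) (by linarith))
    have h4 := hrec k
    have h5 : (k + 4) * (2 * n * b (k + 1)) ≤ (k + 4) * b (k + 2) := by
      rw [h4]
      have : 0 ≤ 4 * (k + 1) * b (k + 1) := by positivity
      nlinarith
    exact le_of_mul_le_mul_left h5 (by linarith)

lemma b_ratio (n : ℕ) (hn : 3 ≤ n) (s : ℝ) (hs : 0 < s) (hs2 : s ^ 2 = 2 * n) (b : ℕ → ℝ)
    (b0 : 0 < b 0) (b1 : b 1 = 2 * n * b 0)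
    (hrec : ∀ k : ℕ, (k + 4) * b (k + 2) =
      2 * n * (2 * k + 5) * b (k + 1) - (4 * n ^ 2 - 8 * n) * (k + 1) * b k) :
    Tendsto (fun k => b (k + 1) / b k) atTop (𝓝 (s ^ 2 + 2 * s)) := by
  have hn' : (3 : ℝ) ≤ n := by exact_mod_cast hn
  have hg := b_growth n hn b b0 b1 hrec
  have hs3 : 2 < s := by nlinarith
  let R : ℕ → ℝ := fun k => b (k + 1) / b k
  have hR : ∀ k, s ^ 2 ≤ R k := fun k => by
    rw [le_div_iff₀ (hg k).1, hs2]; exact (hg k).2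
  let η : ℕ → ℝ := fun k => (-3 * s ^ 2 + 3 * (s ^ 4 - 4 * s ^ 2) / R k) / (k + 4)
  have hη : Tendsto η atTop (𝓝 0) := by
    have h1 : Tendsto (fun k : ℕ => (3 * s ^ 2 + 3 * s ^ 2) / ((k : ℝ) + 4)) atTop (𝓝 0) := by
      apply Tendsto.div_atTop tendsto_const_nhds
      exact tendsto_atTop_add_const_right _ _ tendsto_natCast_atTop_atTop
    apply squeeze_zero_norm _ h1
    intro k
    rw [Real.norm_eq_abs, abs_div, abs_of_pos (show (0 : ℝ) < k + 4 by positivity)]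
    gcongr
    have hRp : 0 < R k := lt_of_lt_of_le (by positivity) (hR k)
    have h2 : 0 ≤ 3 * (s ^ 4 - 4 * s ^ 2) / R k := by
      apply div_nonneg _ hRp.le
      nlinarith [sq_nonneg s]
    have h3 : 3 * (s ^ 4 - 4 * s ^ 2) / R k ≤ 3 * s ^ 2 := by
      rw [div_le_iff₀ hRp]
      nlinarith [hR k, sq_nonneg s]
    rw [abs_le]
    constructor <;> nlinarith [sq_nonneg s]
  have hstep : ∀ k, R (k + 1) - (s ^ 2 + 2 * s) =
      ((s ^ 2 - 2 * s) / R k) * (R k - (s ^ 2 + 2 * s)) + η k := by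
    intro k
    have hRp : 0 < R k := lt_of_lt_of_le (by positivity) (hR k)
    have hb := (hg k).1
    have hb1 := (hg (k + 1)).1
    have h4 : (k + 4) * R (k + 1) = s ^ 2 * (2 * k + 5) - (s ^ 4 - 4 * s ^ 2) * (k + 1) / R k := by
      simp only [R]
      have := hrec k
      have e2 : b (k + 2) = (2 * n * (2 * k + 5) * b (k + 1) - (4 * n ^ 2 - 8 * n) * (k + 1) * b k) / (k + 4) := by
        rw [eq_div_iff (by positivity)]; linarith
      have hn2 : (n : ℝ) = s ^ 2 / 2 := by linarith
      rw [show k + 1 + 1 = k + 2 from rfl, e2, hn2]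
      field_simp
      ring
    have h5 : R (k + 1) = (s ^ 2 * (2 * k + 5) - (s ^ 4 - 4 * s ^ 2) * (k + 1) / R k) / (k + 4) := by
      rw [eq_div_iff (by positivity)]; linarith
    rw [h5]
    simp only [η]
    field_simp
    ring
  apply tendsto_of_contr R η _ ((s ^ 2 - 2 * s) / s ^ 2) (by apply div_nonneg <;> nlinarith)
    (by rw [div_lt_one (by positivity)]; linarith) hη
  intro k
  have hRp : 0 < R k := lt_of_lt_of_le (by positivity) (hR k)
  rw [hstep]
  refine (abs_add_le _ _).trans ?_
  gcongr
  rw [abs_mul]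
  gcongr
  rw [abs_of_nonneg (by apply div_nonneg <;> nlinarith)]
  apply div_le_div_of_nonneg_left (by nlinarith) (by positivity) (hR k)

lemma a_ratio (n : ℕ) (hn : 3 ≤ n) (s : ℝ) (hs : 0 < s) (hs2 : s ^ 2 = 2 * n) (a b : ℕ → ℝ)
    (ha : ∀ k, 0 ≤ a k) (hab : ∀ k, b k = a (k + 2) + a (k + 1))
    (b0 : 0 < b 0) (b1 : b 1 = 2 * n * b 0)
    (hrec : ∀ k : ℕ, (k + 4) * b (k + 2) =
      2 * n * (2 * k + 5) * b (k + 1) - (4 * n ^ 2 - 8 * n) * (k + 1) * b k) :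
    (∀ k, 3 ≤ k → 0 < a k) ∧ Tendsto (fun k => a (k + 1) / a k) atTop (𝓝 (s ^ 2 + 2 * s)) := by
  have hn' : (3 : ℝ) ≤ n := by exact_mod_cast hn
  have hg := b_growth n hn b b0 b1 hrec
  have hR := b_ratio n hn s hs hs2 b b0 b1 hrec
  have hs3 : 2 < s := by nlinarith
  have hpos : ∀ k, 0 < a (k + 3) := by
    intro k
    have h1 := hab (k + 1)
    have h2 := hab k
    have h3 := (hg k).2
    have h4 := (hg k).1
    have h5 := ha (k + 1)
    have h6 : a (k + 1 + 1) = a (k + 2) := rfl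
    have h7 : a (k + 1 + 2) = a (k + 3) := rfl
    nlinarith
  refine ⟨fun k hk => by obtain ⟨j, rfl⟩ := Nat.exists_eq_add_of_le' hk; exact hpos j, ?_⟩
  set α := s ^ 2 + 2 * s with hα
  have hαp : 0 < α := by positivity
  have hv : Tendsto (fun k => a (k + 2) / b k) atTop (𝓝 (α / (α + 1))) := by
    have hη : Tendsto (fun k => α / (α + 1) * (1 / α - 1 / (b (k + 1) / b k))) atTop (𝓝 0) := by
      have : Tendsto (fun k => 1 / (b (k + 1) / b k)) atTop (𝓝 (1 / α)) :=
        tendsto_const_nhds.div hR hαp.ne'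
      simpa using ((tendsto_const_nhds (x := 1 / α)).sub this).const_mul (α / (α + 1))
    apply tendsto_of_contr _ _ _ (1 / 2) (by norm_num) (by norm_num) hη
    intro k
    have h4 := (hg k).1
    have h5 := (hg (k + 1)).1
    have h1 : a (k + 1 + 2) = b (k + 1) - a (k + 2) := by rw [hab (k + 1)]; ring
    have : a (k + 1 + 2) / b (k + 1) - α / (α + 1) =
        -(b k / b (k + 1)) * (a (k + 2) / b k - α / (α + 1)) +
          α / (α + 1) * (1 / α - 1 / (b (k + 1) / b k)) := by
      rw [h1]
      field_simp
      ring
    rw [this]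
    refine (abs_add_le _ _).trans ?_
    gcongr
    rw [abs_mul, abs_neg]
    gcongr
    rw [abs_of_pos (by positivity), div_le_iff₀ h5]
    nlinarith [(hg k).2]
  have h1 := ((hv.comp (tendsto_add_atTop_nat 1)).div hv (by positivity)).mul hR
  rw [div_self (by positivity), one_mul] at h1
  have h2 : Tendsto (fun k => a (k + 2 + 1) / a (k + 2)) atTop (𝓝 α) := by
    refine h1.congr' ?_
    filter_upwards [eventually_ge_atTop 1] with k hk
    obtain ⟨j, rfl⟩ := Nat.exists_eq_add_of_le' hk
    have := (hg (j + 1)).1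
    have := (hg (j + 1 + 1)).1
    have := hpos j
    have e1 : a (j + 1 + 2) = a (j + 3) := rfl
    have e2 : a (j + 1 + 2 + 1) = a (j + 1 + 1 + 2) := rfl
    simp only [Function.comp_apply, Pi.div_apply]
    rw [e2, e1]
    field_simp
  exact (tendsto_add_atTop_iff_nat 2).1 h2

end RatioLemmas

/-! ### Counting -/

namespace NT
open scoped ENNReal
open Filter Topology

variable (n : ℕ)

/-- number of trees of size `m`, as an extended nonnegative real -/
noncomputable def aE (m : ℕ) : ℝ≥0∞ := ∑' t : NT n, if sz t = m then 1 else 0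

/-- number of forests of total size `m` -/
noncomputable def lE (m : ℕ) : ℝ≥0∞ := ∑' l : List (NT n), if tot l = m then 1 else 0

/-- number of forests of at least two trees -/
noncomputable def zE (m : ℕ) : ℝ≥0∞ :=
  ∑' l : {l : List (NT n) // 2 ≤ l.length}, if tot l.1 = m then 1 else 0

lemma aE_zero : aE n 0 = 0 := by
  rw [aE, ENNReal.tsum_eq_zero]
  intro t
  have := sz_pos t
  rw [if_neg (by omega)]

lemma lE_eq (m : ℕ) : lE n m = (if m = 0 then 1 else 0) +
    ∑ p ∈ Finset.HasAntidiagonal.antidiagonal m, aE n p.1 * lE n p.2 := by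
  rw [lE, tsum_list]
  congr 1
  · simp [eq_comm]
  · have h : ∀ p : ℕ × ℕ, aE n p.1 * lE n p.2 =
        ∑' t : NT n, ∑' l : List (NT n), if sz t = p.1 ∧ tot l = p.2 then 1 else 0 := by
      intro p
      rw [aE, ← ENNReal.tsum_mul_right]
      congr 1; ext t
      rw [lE, ← ENNReal.tsum_mul_left]
      congr 1; ext l
      split_ifs <;> simp_all
    simp_rw [h]
    rw [← Summable.tsum_finsetSum (fun _ _ => ENNReal.summable)]
    congr 1; ext t
    rw [← Summable.tsum_finsetSum (fun _ _ => ENNReal.summable)]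
    congr 1; ext l
    by_cases hm : tot (t :: l) = m
    · rw [if_pos hm, Finset.sum_eq_single (sz t, tot l)]
      · simp
      · rintro ⟨p, q⟩ _ hpq
        rw [if_neg]
        rintro ⟨rfl, rfl⟩
        exact hpq rfl
      · intro h
        simp at hm
        simp [hm] at h
    · rw [if_neg hm, Finset.sum_eq_zero]
      rintro ⟨p, q⟩ hpq
      rw [if_neg]
      rintro ⟨rfl, rfl⟩
      simp at hpq hm
      omega

lemma aE_succ (m : ℕ) : aE n (m + 1) = (if m = 0 then (2 * n : ℝ≥0∞) else 0) + zE n m := by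
  rw [aE, tsum_NT, zE]
  congr 1
  · by_cases h : m = 0
    · simp [h]; ring
    · simp [h]
  · congr 1; ext l
    rw [sz_mk]
    congr 1
    rw [add_comm]; simp

lemma lE_eq_two (m : ℕ) : lE n m = (if m = 0 then 1 else 0) + aE n m + zE n m := by
  rw [lE, tsum_list_two, zE, aE]
  simp [eq_comm]

lemma lE_ne_top (m : ℕ) : lE n m ≠ ⊤ ∧ aE n m ≠ ⊤ ∧ zE n m ≠ ⊤ := by
  induction m using Nat.strong_induction_on with
  | _ m ih =>
    have ha : aE n m ≠ ⊤ := by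
      cases m with
      | zero => simp [aE_zero]
      | succ m =>
        rw [aE_succ]
        refine ENNReal.add_ne_top.2 ⟨?_, (ih m (by omega)).2.2⟩
        split_ifs
        · exact ENNReal.mul_ne_top (by simp) (by simp)
        · simp
    have hl : lE n m ≠ ⊤ := by
      rw [lE_eq]
      refine ENNReal.add_ne_top.2 ⟨by split_ifs <;> simp, ?_⟩
      refine ENNReal.sum_ne_top.2 ?_
      rintro ⟨p, q⟩ hpq
      rw [Finset.HasAntidiagonal.mem_antidiagonal] at hpq
      dsimp only at hpq ⊢
      rcases Nat.eq_zero_or_pos p with rfl | hp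
      · simp [aE_zero]
      · refine ENNReal.mul_ne_top ?_ (ih q (by omega)).1
        rcases Nat.lt_or_ge p m with h | h
        · exact (ih p h).2.1
        · have : p = m := by omega
          subst this; exact ha
    refine ⟨hl, ha, ?_⟩
    rw [lE_eq_two] at hl
    exact (ENNReal.add_ne_top.1 hl).2

/-- number of trees of size `m`, as a real -/
noncomputable def aR (m : ℕ) : ℝ := (aE n m).toReal

lemma aR_nonneg (m : ℕ) : 0 ≤ aR n m := ENNReal.toReal_nonneg

open PowerSeries in
lemma ps_quadratic :
    (PowerSeries.mk (aR n)) - (PowerSeries.mk (aR n)) ^ 2 =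
      C (2 * n : ℝ) * X * (1 - PowerSeries.mk (aR n)) + X * (PowerSeries.mk (aR n)) ^ 2 := by
  set P : PowerSeries ℝ := PowerSeries.mk (aR n) with hP
  set L : PowerSeries ℝ := PowerSeries.mk (fun m => (lE n m).toReal) with hL
  have h1 : L = 1 + P * L := by
    ext m
    rw [map_add, PowerSeries.coeff_mul, coeff_one]
    simp only [hP, hL, coeff_mk]
    rw [lE_eq, ENNReal.toReal_add (by split_ifs <;> simp), ENNReal.toReal_sum]
    · congr 1
      · split_ifs <;> simp
      · apply Finset.sum_congr rfl
        intro p _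
        rw [ENNReal.toReal_mul, aR]
    · intro p _
      exact ENNReal.mul_ne_top (lE_ne_top n _).2.1 (lE_ne_top n _).1
    · exact ENNReal.sum_ne_top.2 fun p _ =>
        ENNReal.mul_ne_top (lE_ne_top n _).2.1 (lE_ne_top n _).1
  have h2 : P = C (2 * n : ℝ) * X + X * (L - 1 - P) := by
    ext m
    cases m with
    | zero => simp [hP, aR, aE_zero]
    | succ m =>
      rw [map_add, coeff_succ_X_mul, coeff_succ_mul_X, map_sub, map_sub, coeff_one, coeff_C]
      simp only [hP, hL, coeff_mk, aR]
      have e := congrArg ENNReal.toReal (lE_eq_two n m)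
      have e2 := congrArg ENNReal.toReal (aE_succ n m)
      rw [ENNReal.toReal_add _ (lE_ne_top n m).2.2, ENNReal.toReal_add _ (lE_ne_top n m).2.1] at e
      · rw [ENNReal.toReal_add _ (lE_ne_top n m).2.2] at e2
        · rw [e, e2]
          split_ifs <;> simp <;> ring
        · split_ifs
          · exact ENNReal.mul_ne_top (by simp) (by simp)
          · simp
      · split_ifs <;> simp
      · exact ENNReal.add_ne_top.2 ⟨by split_ifs <;> simp, (lE_ne_top n m).2.1⟩
  linear_combination (1 - P) * h2 + X * h1

lemma aR_one : aR n 1 = 2 * n := by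
  have e := lE_eq_two n 0
  have h0 : lE n 0 = 1 := by rw [lE_eq]; simp [aE_zero]
  rw [h0, aE_zero] at e
  have hz : zE n 0 = 0 := by
    have : (1 : ℝ≥0∞) + 0 = 1 + zE n 0 := by simpa using e
    exact ((ENNReal.add_right_inj ENNReal.one_ne_top).1 this).symm
  rw [aR, aE_succ n 0, hz]
  simp

open PowerSeries in
lemma aR_rec (k : ℕ) : ((k : ℝ) + 4) * (aR n (k + 4) + aR n (k + 3)) =
      2 * n * (2 * k + 5) * (aR n (k + 3) + aR n (k + 2)) -
        (4 * n ^ 2 - 8 * n) * (k + 1) * (aR n (k + 2) + aR n (k + 1)) ∧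
      aR n 3 + aR n 2 = 2 * n * (aR n 2 + aR n 1) := by
  set P : PowerSeries ℝ := PowerSeries.mk (aR n) with hP
  have hq := ps_quadratic n
  rw [← hP] at hq
  set Y : PowerSeries ℝ := 1 + C (2 * n : ℝ) * X - 2 * (P + X * P) with hY
  have hc2 : (C (2 * n : ℝ) : PowerSeries ℝ) = 2 * C (n : ℝ) := by
    rw [map_mul]; rfl
  have hD : Y ^ 2 = 1 - C (4 * n : ℝ) * X + C (4 * n ^ 2 - 8 * n : ℝ) * X ^ 2 := by
    have e1 : (C (4 * n : ℝ) : PowerSeries ℝ) = 4 * C (n : ℝ) := by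
      rw [map_mul]; rfl
    have e2 : (C (4 * n ^ 2 - 8 * n : ℝ) : PowerSeries ℝ) = 4 * C (n : ℝ) ^ 2 - 8 * C (n : ℝ) := by
      rw [map_sub, map_mul, map_mul, map_pow]; rfl
    rw [e1, e2, hY]
    rw [hc2] at hq ⊢
    linear_combination (-4 * (1 + X)) * hq
  set q : ℝ := 4 * n ^ 2 - 8 * n with hqd
  have hder := congrArg (derivative ℝ) hD
  have hXd : (derivative ℝ) (X : PowerSeries ℝ) = 1 := derivative_X
  have hd2 : 2 * Y * (derivative ℝ) Y = - C (4 * n : ℝ) + 2 * C q * X := by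
    simp only [Derivation.leibniz_pow, map_add, map_sub, Derivation.leibniz, derivative_C, hXd,
      Derivation.map_one_eq_zero, smul_eq_mul, nsmul_eq_mul] at hder
    push_cast at hder
    linear_combination hder
  have hE : 2 * (derivative ℝ) Y - C (8 * n : ℝ) * (X * (derivative ℝ) Y) +
      C (2 * q) * (X * (X * (derivative ℝ) Y)) = - C (4 * n : ℝ) * Y + C (2 * q) * (X * Y) := by
    have e1 : (C (8 * n : ℝ) : PowerSeries ℝ) = 2 * C (4 * n : ℝ) := by
      rw [show (8 * n : ℝ) = 2 * (4 * n) by ring, map_mul]; rfl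
    have e2 : (C (2 * q : ℝ) : PowerSeries ℝ) = 2 * C q := by
      rw [map_mul]; rfl
    rw [e1, e2]
    linear_combination Y * hd2 - 2 * (derivative ℝ) Y * hD
  have h2c : (2 : PowerSeries ℝ) = C (2 : ℝ) := by rfl
  have hYc : ∀ k, coeff (k + 2) Y = -2 * (aR n (k + 2) + aR n (k + 1)) := by
    intro k
    rw [hY, h2c, map_sub, map_add, coeff_one, coeff_C_mul, coeff_C_mul, coeff_X, map_add,
      coeff_succ_X_mul]
    simp [hP]
  have hrec : ∀ k : ℕ, 2 * ((k : ℝ) + 3) * coeff (k + 3) Y - 8 * n * ((k + 2) * coeff (k + 2) Y)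
      + 2 * q * ((k + 1) * coeff (k + 1) Y) = - (4 * n) * coeff (k + 2) Y
      + 2 * q * coeff (k + 1) Y := by
    intro k
    have := congrArg (coeff (k + 2)) hE
    rw [h2c, ← map_neg C, map_add, map_sub, map_add, coeff_C_mul, coeff_C_mul, coeff_C_mul, coeff_C_mul,
      coeff_C_mul, coeff_succ_X_mul, coeff_succ_X_mul, coeff_succ_X_mul, coeff_succ_X_mul,
      coeff_derivative, coeff_derivative, coeff_derivative] at this
    push_cast at this
    linear_combination this
  constructor
  · have := hrec (k + 1)
    rw [hYc (k + 2), hYc (k + 1), hYc k] at this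
    push_cast at this
    linear_combination (-1 / 4) * this
  · have := hrec 0
    rw [hYc 1, hYc 0] at this
    push_cast at this
    linear_combination (-1 / 12) * this

lemma aR_ratio (hn : 3 ≤ n) (s : ℝ) (hs : 0 < s) (hs2 : s ^ 2 = 2 * n) :
    (∀ k, 3 ≤ k → 0 < aR n k) ∧
      Tendsto (fun k => aR n (k + 1) / aR n k) atTop (𝓝 (s ^ 2 + 2 * s)) := by
  have hn' : (3 : ℝ) ≤ n := by exact_mod_cast hn
  refine a_ratio n hn s hs hs2 (aR n) (fun k => aR n (k + 2) + aR n (k + 1)) (aR_nonneg n)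
    (fun k => rfl) ?_ (aR_rec n 0).2 (fun k => (aR_rec n k).1)
  have := aR_nonneg n 2
  have := aR_one n
  simp only [zero_add]
  linarith

end NT

/-! ### Weights -/

namespace NT
open scoped ENNReal
open Filter Topology

lemma tsum_list_ge_two {α : Type*} (φ : α → ℝ≥0∞) :
    ∑' l : {l : List α // 2 ≤ l.length}, (l.1.map φ).prod =
      (∑' a, φ a) ^ 2 * (1 - ∑' a, φ a)⁻¹ := by
  have h : ∑' l : {l : List α // 2 ≤ l.length}, (l.1.map φ).prod =
      ∑' l : List α, {l : List α | 2 ≤ l.length}.indicator (fun l => (l.map φ).prod) l :=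
    tsum_subtype {l : List α | 2 ≤ l.length} (fun l => (l.map φ).prod)
  rw [h, tsum_list]
  have h2 : ∀ a : α, ∑' l : List α, {l : List α | 2 ≤ l.length}.indicator
      (fun l => (l.map φ).prod) (a :: l) = φ a * ((∑' a, φ a) * (1 - ∑' a, φ a)⁻¹) := by
    intro a
    rw [tsum_list]
    have h3 : ∀ b (l : List α), {l : List α | 2 ≤ l.length}.indicator
      (fun l => (l.map φ).prod) (a :: b :: l) = φ a * (φ b * (l.map φ).prod) := by
      intro b l
      rw [Set.indicator_of_mem (by simp)]
      simp
    simp_rw [h3, ENNReal.tsum_mul_left, tsum_list_prod, ENNReal.tsum_mul_right]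
    rw [Set.indicator_of_notMem (by simp), zero_add]
  simp_rw [h2, ENNReal.tsum_mul_right]
  rw [Set.indicator_of_notMem (by simp), zero_add]
  ring

/-- the critical weight -/
noncomputable def rr (s : ℝ) : ℝ≥0∞ := ENNReal.ofReal (1 / (s * (s + 2)))

variable {n : ℕ}

lemma pow_tot (r : ℝ≥0∞) (l : List (NT n)) : r ^ tot l = (l.map (fun t => r ^ sz t)).prod := by
  induction l with
  | nil => simp
  | cons a l ih => simp [pow_add, ih]

lemma tsum_pow_tot (r : ℝ≥0∞) : ∑' l : List (NT n), r ^ tot l = (1 - ∑' t : NT n, r ^ sz t)⁻¹ := by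
  rw [← tsum_list_prod]
  congr 1; ext l; exact pow_tot r l

lemma tau_eq (r : ℝ≥0∞) : ∑' t : NT n, r ^ sz t = 2 * n * r +
    r * ((∑' t : NT n, r ^ sz t) ^ 2 * (1 - ∑' t : NT n, r ^ sz t)⁻¹) := by
  conv_lhs => rw [tsum_NT]
  rw [← tsum_list_ge_two, ← ENNReal.tsum_mul_left]
  congr 1
  · simp; ring
  · congr 1; ext l
    rw [sz_mk, pow_add, pow_tot]; simp

lemma le_tot_of_mem {l : List (NT n)} {t : NT n} (h : t ∈ l) : sz t ≤ tot l :=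
  List.le_sum_of_mem (List.mem_map_of_mem h)

lemma tau_le (r τ : ℝ≥0∞) (h : 2 * n * r + r * (τ ^ 2 * (1 - τ)⁻¹) ≤ τ) :
    ∑' t : NT n, r ^ sz t ≤ τ := by
  classical
  have key : ∀ M, ∑' t : NT n, (if sz t ≤ M then r ^ sz t else 0) ≤ τ := by
    intro M
    induction M with
    | zero =>
      rw [ENNReal.tsum_eq_zero.2]
      · exact zero_le
      · intro t
        have := sz_pos t
        rw [if_neg (by omega)]
    | succ M ih =>
      refine le_trans ?_ h
      rw [tsum_NT]
      refine add_le_add (le_of_eq (by simp; ring)) ?_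
      have : r * ((∑' t : NT n, (if sz t ≤ M then r ^ sz t else 0)) ^ 2 *
          (1 - ∑' t : NT n, (if sz t ≤ M then r ^ sz t else 0))⁻¹) ≤ r * (τ ^ 2 * (1 - τ)⁻¹) := by
        gcongr
      refine le_trans ?_ this
      rw [← tsum_list_ge_two, ← ENNReal.tsum_mul_left]
      refine ENNReal.tsum_le_tsum fun l => ?_
      rw [sz_mk]
      split_ifs with hM
      · rw [pow_add, pow_tot, pow_one]
        refine le_of_eq ?_
        congr 2
        apply List.map_congr_left
        intro t ht
        have := le_tot_of_mem ht
        rw [if_pos (by omega)]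
      · exact zero_le
  rw [ENNReal.tsum_eq_iSup_sum]
  refine iSup_le fun F => ?_
  refine le_trans ?_ (key (F.sup sz))
  refine le_trans ?_ (ENNReal.sum_le_tsum F)
  refine Finset.sum_le_sum fun t ht => ?_
  rw [if_pos (Finset.le_sup ht)]

lemma tau_val (s : ℝ) (hs : 0 < s) (hs2 : s ^ 2 = 2 * n) :
    ∑' t : NT n, rr s ^ sz t = ENNReal.ofReal (s / (s + 1)) := by
  have e1 : (1 : ℝ≥0∞) - ENNReal.ofReal (s / (s + 1)) = ENNReal.ofReal (1 / (s + 1)) := by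
    rw [← ENNReal.ofReal_one, ← ENNReal.ofReal_sub _ (by positivity)]
    congr 1; field_simp; ring
  have hn2 : (2 * n : ℝ≥0∞) = ENNReal.ofReal (s ^ 2) := by
    rw [hs2, ENNReal.ofReal_mul (by norm_num)]; simp
  have hle : ∑' t : NT n, rr s ^ sz t ≤ ENNReal.ofReal (s / (s + 1)) := by
    apply tau_le
    rw [e1, ← ENNReal.ofReal_inv_of_pos (by positivity), hn2, rr, ← ENNReal.ofReal_pow (by positivity),
      ← ENNReal.ofReal_mul (by positivity), ← ENNReal.ofReal_mul (by positivity),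
      ← ENNReal.ofReal_mul (by positivity), ← ENNReal.ofReal_add (by positivity) (by positivity)]
    apply ENNReal.ofReal_le_ofReal
    apply le_of_eq
    field_simp
    ring
  have heq := tau_eq (n := n) (rr s)
  set T : ℝ≥0∞ := ∑' t : NT n, rr s ^ sz t with hT
  have hTtop : T ≠ ⊤ := ne_top_of_le_ne_top ENNReal.ofReal_ne_top hle
  obtain ⟨x, hx0, hx⟩ : ∃ x : ℝ, 0 ≤ x ∧ T = ENNReal.ofReal x :=
    ⟨T.toReal, ENNReal.toReal_nonneg, (ENNReal.ofReal_toReal hTtop).symm⟩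
  rw [hx] at heq hle ⊢
  have hxle : x ≤ s / (s + 1) := (ENNReal.ofReal_le_ofReal_iff (by positivity)).1 hle
  have hx1 : 0 < 1 - x := by
    have : s / (s + 1) < 1 := by rw [div_lt_one (by positivity)]; linarith
    linarith
  have e2 : (1 : ℝ≥0∞) - ENNReal.ofReal x = ENNReal.ofReal (1 - x) := by
    rw [← ENNReal.ofReal_one, ← ENNReal.ofReal_sub _ hx0]
  rw [e2, ← ENNReal.ofReal_inv_of_pos hx1, hn2, rr, ← ENNReal.ofReal_pow hx0,
      ← ENNReal.ofReal_mul (by positivity), ← ENNReal.ofReal_mul (by positivity),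
      ← ENNReal.ofReal_mul (by positivity), ← ENNReal.ofReal_add (by positivity) (by positivity),
      ENNReal.ofReal_eq_ofReal_iff hx0 (by positivity)] at heq
  congr 1
  field_simp at heq
  have : (x * (s + 1) - s) ^ 2 = 0 := by
    linear_combination -heq
  have := pow_eq_zero_iff (two_ne_zero) |>.1 this
  rw [eq_div_iff (by positivity)]; linarith

lemma tsum_wl (s : ℝ) (hs : 0 < s) (hs2 : s ^ 2 = 2 * n) :
    ∑' l : List (NT n), rr s ^ tot l = ENNReal.ofReal (s + 1) := by
  rw [tsum_pow_tot, tau_val s hs hs2]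
  have e1 : (1 : ℝ≥0∞) - ENNReal.ofReal (s / (s + 1)) = ENNReal.ofReal (1 / (s + 1)) := by
    rw [← ENNReal.ofReal_one, ← ENNReal.ofReal_sub _ (by positivity)]
    congr 1; field_simp; ring
  rw [e1, ← ENNReal.ofReal_inv_of_pos (by positivity)]
  simp

/-- contexts: a node with a hole -/
abbrev Ctx (n : ℕ) := {p : List (NT n) × List (NT n) // p ≠ ([], [])}

/-- size of a context -/
def cs (C : Ctx n) : ℕ := 1 + tot C.1.1 + tot C.1.2

/-- action of a context on Boolean functions -/
def act (C : Ctx n) (h : (Fin n → Bool) → Bool) (x : Fin n → Bool) : Bool :=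
  nor C.1.1 x && nor C.1.2 x && !h x

/-- plugging a tree in a context -/
def plug (C : Ctx n) (t : NT n) : NT n := mk (C.1.1 ++ t :: C.1.2) (by
  have := C.2
  rcases C with ⟨⟨l1, l2⟩, h⟩
  cases l1 <;> cases l2 <;> simp at h ⊢
  omega)

lemma sz_plug (C : Ctx n) (t : NT n) : sz (plug C t) = cs C + sz t := by
  rw [plug, sz_mk, cs]; simp; ring

lemma ev_plug (C : Ctx n) (t : NT n) : ev (plug C t) = act C (ev t) := by
  rw [plug, ev_mk]; funext x; simp [act, nor]
  cases List.all C.1.1 (fun t => !ev t x) <;> cases List.all C.1.2 (fun t => !ev t x) <;>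
    cases ev t x <;> rfl

lemma tsum_ctx (f : List (NT n) × List (NT n) → ℝ≥0∞) :
    ∑' p, f p = f ([], []) + ∑' C : Ctx n, f C.1 := by
  classical
  have h1 : ∀ p, f p = (if p = ([], []) then f ([], []) else 0) +
      {p : List (NT n) × List (NT n) | p ≠ ([], [])}.indicator f p := by
    intro p
    by_cases h : p = ([], [])
    · subst h; simp
    · rw [if_neg h, zero_add, Set.indicator_of_mem (by exact h)]
  rw [tsum_congr h1, ENNReal.tsum_add, tsum_ite_eq]
  congr 1
  exact (tsum_subtype {p : List (NT n) × List (NT n) | p ≠ ([], [])} f).symm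

lemma tsum_pair_wl (s : ℝ) (hs : 0 < s) (hs2 : s ^ 2 = 2 * n) :
    ∑' C : Ctx n, rr s ^ cs C = 1 := by
  have h := tsum_ctx (n := n) (fun p => rr s * (rr s ^ tot p.1 * rr s ^ tot p.2))
  rw [ENNReal.tsum_mul_left, ENNReal.tsum_prod (f := fun a b : List (NT n) =>
    rr s ^ tot a * rr s ^ tot b)] at h
  simp_rw [ENNReal.tsum_mul_left, ENNReal.tsum_mul_right] at h
  rw [tsum_wl s hs hs2] at h
  have e : ∀ C : Ctx n, rr s * (rr s ^ tot C.1.1 * rr s ^ tot C.1.2) = rr s ^ cs C := by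
    intro C; rw [cs, pow_add, pow_add, pow_one, mul_assoc]
  rw [← ENNReal.tsum_mul_left (α := Ctx n), tsum_congr e] at h
  simp only [tot_nil, pow_zero, mul_one] at h
  have h2 : rr s * (ENNReal.ofReal (s + 1) * ENNReal.ofReal (s + 1)) = rr s + 1 := by
    rw [rr, ← ENNReal.ofReal_mul (by positivity), ← ENNReal.ofReal_mul (by positivity),
      ← ENNReal.ofReal_one, ← ENNReal.ofReal_add (by positivity) (by positivity)]
    congr 1; field_simp; ring
  rw [h2] at h
  exact ((ENNReal.add_right_inj (by simp [rr])).1 h).symm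

end NT

/-! ### Existence of the limit -/

namespace NT
open scoped ENNReal
open Filter Topology

lemma tsum_liminf_le {ι : Type*} (f : ℕ → ι → ℝ≥0∞) :
    ∑' i, liminf (fun m => f m i) atTop ≤ liminf (fun m => ∑' i, f m i) atTop := by
  let _ : MeasurableSpace ι := ⊤
  have h := MeasureTheory.lintegral_liminf_le (μ := MeasureTheory.Measure.count) (f := f)
    (u := atTop) (fun _ => measurable_from_top)
  simpa only [MeasureTheory.lintegral_count] using h

lemma tendsto_of_liminf_sum {ι : Type*} [Fintype ι] (r : ℕ → ι → ℝ) (μ : ι → ℝ)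
    (hr : ∀ᶠ m in atTop, ∑ i, r m i = 1) (hμ : ∑ i, μ i = 1)
    (h : ∀ i, ∀ a < μ i, ∀ᶠ m in atTop, a < r m i) (i : ι) :
    Tendsto (fun m => r m i) atTop (𝓝 (μ i)) := by
  classical
  rw [tendsto_order]
  refine ⟨h i, ?_⟩
  intro b hb
  set k : ℝ := (Fintype.card ι : ℝ) with hk
  have hk0 : 0 < k := by
    have : Nonempty ι := ⟨i⟩
    rw [hk]; exact_mod_cast Fintype.card_pos (α := ι)
  set ε : ℝ := (b - μ i) / k with hε
  have hε0 : 0 < ε := div_pos (by linarith) hk0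
  have hev : ∀ᶠ m in atTop, ∀ j, μ j - ε < r m j := by
    rw [Filter.eventually_all]
    intro j
    exact h j _ (by linarith)
  filter_upwards [hr, hev] with m h1 h2
  have e1 := Finset.add_sum_erase Finset.univ (fun j => r m j - (μ j - ε)) (Finset.mem_univ i)
  have e2 : ∑ j, (r m j - (μ j - ε)) = b - μ i := by
    rw [Finset.sum_sub_distrib, Finset.sum_sub_distrib, h1, hμ]
    simp only [Finset.sum_const, Finset.card_univ, nsmul_eq_mul]
    rw [hε, ← hk]; field_simp; ring
  have e3 : 0 ≤ ∑ j ∈ Finset.univ.erase i, (r m j - (μ j - ε)) :=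
    Finset.sum_nonneg fun j _ => by linarith [h2 j]
  rw [e2] at e1
  linarith

variable {n : ℕ}

lemma mk_inj {l l' : List (NT n)} {h h'} (e : mk l h = mk l' h') : l = l' := by
  have : eqv.symm (Sum.inr ⟨l, h⟩) = eqv.symm (Sum.inr ⟨l', h'⟩) := e
  simpa using eqv.symm.injective this

lemma split_inj {α : Type*} (P : α → Prop) (l1 l2 l1' l2' : List α) (t t' : α)
    (h1 : ∀ x ∈ l1, ¬ P x) (h1' : ∀ x ∈ l1', ¬ P x) (ht : P t) (ht' : P t')
    (e : l1 ++ t :: l2 = l1' ++ t' :: l2') : l1 = l1' ∧ t = t' ∧ l2 = l2' := by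
  induction l1 generalizing l1' with
  | nil =>
    cases l1' with
    | nil => simpa using e
    | cons a l1' =>
      simp only [List.nil_append, List.cons_append, List.cons.injEq] at e
      exact absurd (e.1 ▸ ht) (h1' a (by simp))
  | cons a l1 ih =>
    cases l1' with
    | nil =>
      simp only [List.nil_append, List.cons_append, List.cons.injEq] at e
      exact absurd (e.1 ▸ ht') (h1 a (by simp))
    | cons b l1' =>
      simp only [List.cons_append, List.cons.injEq] at e
      obtain ⟨h2, h3, h4⟩ := ih l1' (fun x hx => h1 x (by simp [hx]))
        (fun x hx => h1' x (by simp [hx])) e.2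
      exact ⟨by rw [e.1, h2], h3, h4⟩

lemma plug_inj (m : ℕ) (C C' : Ctx n) (t t' : NT n) (hC : 2 * cs C < m) (hC' : 2 * cs C' < m)
    (ht : cs C + sz t = m) (ht' : cs C' + sz t' = m) (e : plug C t = plug C' t') :
    C = C' ∧ t = t' := by
  have e' := mk_inj e
  have hl : ∀ x ∈ C.1.1, ¬ m ≤ 2 * sz x := by
    intro x hx
    have := le_tot_of_mem hx
    unfold cs at hC
    omega
  have hl' : ∀ x ∈ C'.1.1, ¬ m ≤ 2 * sz x := by
    intro x hx
    have := le_tot_of_mem hx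
    unfold cs at hC'
    omega
  obtain ⟨h1, h2, h3⟩ := split_inj (fun x : NT n => m ≤ 2 * sz x) _ _ _ _ _ _ hl hl'
    (by omega) (by omega) e'
  exact ⟨Subtype.ext (Prod.ext h1 h3), h2⟩

/-- number of trees of size `m` computing `g` -/
noncomputable def cE (g : (Fin n → Bool) → Bool) (m : ℕ) : ℝ≥0∞ :=
  ∑' t : NT n, if ev t = g ∧ sz t = m then 1 else 0

lemma sum_cE (m : ℕ) : ∑ g, cE (n := n) g m = aE n m := by
  simp_rw [cE, aE]
  rw [← Summable.tsum_finsetSum (fun _ _ => ENNReal.summable)]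
  congr 1; ext t
  by_cases h : sz t = m <;> simp [h]

lemma cE_le (g : (Fin n → Bool) → Bool) (m : ℕ) : cE g m ≤ aE n m := by
  rw [← sum_cE]
  exact Finset.single_le_sum (f := fun g => cE g m) (fun _ _ => zero_le) (Finset.mem_univ g)

lemma cE_ge (g : (Fin n → Bool) → Bool) (m : ℕ) :
    ∑' C : Ctx n, (if 2 * cs C < m then
      ∑ h, (if act C h = g then cE h (m - cs C) else 0) else 0) ≤ cE g m := by
  let S : Set (Ctx n × NT n) := {p | 2 * cs p.1 < m ∧ cs p.1 + sz p.2 = m}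
  have hinj : Function.Injective (fun p : S => plug p.1.1 p.1.2) := by
    rintro ⟨⟨C, t⟩, h1, h2⟩ ⟨⟨C', t'⟩, h1', h2'⟩ e
    obtain ⟨rfl, rfl⟩ := plug_inj m C C' t t' h1 h1' h2 h2' e
    rfl
  have hle := ENNReal.tsum_comp_le_tsum_of_injective hinj
    (fun t : NT n => if ev t = g ∧ sz t = m then (1 : ℝ≥0∞) else 0)
  refine le_trans (le_of_eq ?_) hle
  rw [tsum_subtype S (fun p => if ev (plug p.1 p.2) = g ∧ sz (plug p.1 p.2) = m
    then (1 : ℝ≥0∞) else 0), ENNReal.tsum_prod']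
  congr 1; ext C
  split_ifs with hC
  · simp_rw [cE]
    have e1 : ∀ h : (Fin n → Bool) → Bool, (if act C h = g then
        ∑' t : NT n, (if ev t = h ∧ sz t = m - cs C then (1 : ℝ≥0∞) else 0) else 0) =
        ∑' t : NT n, (if act C h = g ∧ ev t = h ∧ sz t = m - cs C then 1 else 0) := by
      intro h
      split_ifs with hh <;> simp [hh]
    simp_rw [e1]
    rw [← Summable.tsum_finsetSum (fun _ _ => ENNReal.summable)]
    congr 1; ext t
    rw [Finset.sum_eq_single (ev t)]
    · simp only [Set.indicator, S, Set.mem_ofPred_eq, ev_plug, sz_plug, hC, true_and]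
      have : (sz t = m - cs C) ↔ cs C + sz t = m := by omega
      by_cases h1 : cs C + sz t = m
      · have h2 : cs C + (m - cs C) = m := by omega
        simp [this.2 h1, h2]
      · rw [if_neg (fun h => h1 (this.1 h.2)), if_neg h1]
    · intro h _ hne
      rw [if_neg]
      rintro ⟨_, h2, _⟩
      exact hne h2.symm
    · simp
  · symm
    rw [ENNReal.tsum_eq_zero]
    intro t
    apply Set.indicator_of_notMem
    rintro ⟨h1, _⟩
    exact hC h1

lemma aE_ofReal (m : ℕ) : aE n m = ENNReal.ofReal (aR n m) :=
  (ENNReal.ofReal_toReal (lE_ne_top n m).2.1).symm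

/-- the ratio of trees computing `g` -/
noncomputable def rE (m : ℕ) (g : (Fin n → Bool) → Bool) : ℝ≥0∞ := cE g m / aE n m

/-- the limiting distribution -/
noncomputable def mu (g : (Fin n → Bool) → Bool) : ℝ≥0∞ := liminf (fun m => rE m g) atTop

section
variable (hn : 3 ≤ n) {s : ℝ} (hs : 0 < s) (hs2 : s ^ 2 = 2 * n)
include hn hs hs2

lemma tendsto_aE (c : ℕ) : Tendsto (fun k => aE n k / aE n (k + c)) atTop (𝓝 (rr s ^ c)) := by
  obtain ⟨hpos, hlim⟩ := aR_ratio n hn s hs hs2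
  have hreal : Tendsto (fun k => aR n k / aR n (k + c)) atTop (𝓝 ((1 / (s * (s + 2))) ^ c)) := by
    induction c with
    | zero =>
      refine Tendsto.congr' ?_ (tendsto_const_nhds (x := (1 : ℝ)))
      filter_upwards [eventually_ge_atTop 3] with k hk
      have := hpos k hk
      simp [this.ne']
    | succ c ih =>
      have h1 : Tendsto (fun k => (aR n (k + c + 1) / aR n (k + c))⁻¹) atTop
          (𝓝 ((s ^ 2 + 2 * s)⁻¹)) :=
        (hlim.comp (tendsto_add_atTop_nat c)).inv₀ (by positivity)
      have h2 := ih.mul h1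
      have : (1 / (s * (s + 2))) ^ c * (s ^ 2 + 2 * s)⁻¹ = (1 / (s * (s + 2))) ^ (c + 1) := by
        rw [pow_succ]; congr 1; rw [one_div]; congr 1; ring
      rw [this] at h2
      refine Tendsto.congr' ?_ h2
      filter_upwards [eventually_ge_atTop 3] with k hk
      have := hpos (k + c) (by omega)
      have := hpos (k + c + 1) (by omega)
      rw [show k + (c + 1) = k + c + 1 by ring]
      field_simp
  have := (ENNReal.tendsto_ofReal hreal)
  rw [ENNReal.ofReal_pow (by positivity)] at this
  refine Tendsto.congr' ?_ this
  filter_upwards [eventually_ge_atTop 3] with k hk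
  rw [ENNReal.ofReal_div_of_pos (hpos (k + c) (by omega)), aE_ofReal, aE_ofReal]

lemma aE_pos (m : ℕ) (hm : 3 ≤ m) : aE n m ≠ 0 := by
  rw [aE_ofReal]
  simpa using (aR_ratio n hn s hs hs2).1 m hm

lemma sum_rE (m : ℕ) (hm : 3 ≤ m) : ∑ g, rE (n := n) m g = 1 := by
  simp_rw [rE, div_eq_mul_inv]
  rw [← Finset.sum_mul, sum_cE]
  exact ENNReal.mul_inv_cancel (aE_pos hn hs hs2 m hm) (lE_ne_top n m).2.1

/-- lower bound for the contribution of a context -/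
lemma ctx_liminf (C : Ctx n) (H : Finset ((Fin n → Bool) → Bool)) (v : ℝ≥0∞)
    (hv : v ≤ liminf (fun m => ∑ h ∈ H, rE m h) atTop) :
    rr s ^ cs C * v ≤ liminf (fun m => (if 2 * cs C < m then
      ∑ h ∈ H, cE h (m - cs C) else 0) / aE n m) atTop := by
  rw [← Filter.liminf_nat_add _ (cs C)]
  have h1 := (tendsto_aE hn hs hs2 (cs C)).liminf_eq
  rw [← h1]
  refine le_trans (mul_le_mul_right hv _) ?_
  refine le_trans ENNReal.le_liminf_mul ?_
  refine Filter.liminf_le_liminf ?_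
  filter_upwards [eventually_ge_atTop (3 + cs C)] with k hk
  rw [if_pos (by omega), Nat.add_sub_cancel]
  simp only [Pi.mul_apply, rE, div_eq_mul_inv]
  rw [← Finset.sum_mul]
  have ha := aE_pos hn hs hs2 k (by omega)
  have ha' := (lE_ne_top n k).2.1
  calc aE n k * (aE n (k + cs C))⁻¹ * ((∑ h ∈ H, cE h k) * (aE n k)⁻¹)
      = (aE n k * (aE n k)⁻¹) * ((∑ h ∈ H, cE h k) * (aE n (k + cs C))⁻¹) := by ring
    _ = (∑ h ∈ H, cE h k) * (aE n (k + cs C))⁻¹ := by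
      rw [ENNReal.mul_inv_cancel ha ha', one_mul]
    _ ≤ _ := le_rfl

lemma mu_ge (g : (Fin n → Bool) → Bool) (L : Ctx n → ℝ≥0∞)
    (hL : ∀ C, L C ≤ liminf (fun m => ∑ h ∈ Finset.univ.filter (fun h => act C h = g), rE m h)
      atTop) : ∑' C, rr s ^ cs C * L C ≤ mu g := by
  have h1 : ∑' C, rr s ^ cs C * L C ≤ ∑' C, liminf (fun m => (if 2 * cs C < m then
      ∑ h ∈ Finset.univ.filter (fun h => act C h = g), cE h (m - cs C) else 0) / aE n m) atTop :=
    ENNReal.tsum_le_tsum fun C => ctx_liminf hn hs hs2 C _ _ (hL C)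
  refine h1.trans ((tsum_liminf_le _).trans ?_)
  refine Filter.liminf_le_liminf (Eventually.of_forall fun m => ?_)
  simp_rw [rE, div_eq_mul_inv]
  rw [ENNReal.tsum_mul_right]
  refine mul_le_mul_left ?_ _
  refine le_trans (le_of_eq ?_) (cE_ge g m)
  congr 1; ext C
  rw [Finset.sum_filter]

lemma sum_liminf_le (H : Finset ((Fin n → Bool) → Bool)) :
    ∑ h ∈ H, mu h ≤ liminf (fun m => ∑ h ∈ H, rE m h) atTop := by
  have := tsum_liminf_le (fun m (h : H) => rE m h.1)
  simp_rw [tsum_fintype] at this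
  rw [← Finset.sum_coe_sort]
  refine this.trans (le_of_eq ?_)
  congr 1; ext m
  exact Finset.sum_coe_sort H (fun h => rE m h)

lemma sum_mu_le : ∑ g, mu (n := n) g ≤ 1 := by
  refine (sum_liminf_le hn hs hs2 Finset.univ).trans (le_of_eq ?_)
  have : (fun m => ∑ g, rE (n := n) m g) =ᶠ[atTop] fun _ => 1 := by
    filter_upwards [eventually_ge_atTop 3] with m hm using sum_rE hn hs hs2 m hm
  rw [Filter.liminf_congr this]
  simp

lemma sum_mu : ∑ g, mu (n := n) g = 1 := by
  classical
  refine le_antisymm (sum_mu_le hn hs hs2) ?_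
  let i0 : Fin n := ⟨0, by omega⟩
  let C0 : Ctx n := ⟨([leaf i0 true, leaf i0 false], []), by simp⟩
  have hC0 : ∀ h, act C0 h = fun _ => false := by
    intro h; funext x
    simp only [act, nor, C0, List.all_cons, List.all_nil, ev_leaf]
    cases x i0 <;> simp
  set S : ℝ≥0∞ := ∑ g, mu (n := n) g with hS
  let L : ((Fin n → Bool) → Bool) → Ctx n → ℝ≥0∞ := fun g C =>
    if C = C0 then (if g = (fun _ => false) then 1 else 0) else
      ∑ h ∈ Finset.univ.filter (fun h => act C h = g), mu h
  have hL : ∀ g C, L g C ≤ liminf (fun m => ∑ h ∈ Finset.univ.filter (fun h => act C h = g),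
      rE m h) atTop := by
    intro g C
    by_cases hC : C = C0
    · simp only [L, if_pos hC]
      split_ifs with hg
      · have : (fun m => ∑ h ∈ Finset.univ.filter (fun h => act C h = g), rE m h)
            =ᶠ[atTop] fun _ => 1 := by
          filter_upwards [eventually_ge_atTop 3] with m hm
          rw [Finset.filter_true_of_mem, sum_rE hn hs hs2 m hm]
          intro h _
          rw [hC, hC0, hg]
        rw [Filter.liminf_congr this]
        simp
      · exact zero_le
    · simp only [L, if_neg hC]
      exact sum_liminf_le hn hs hs2 _
  have hsumL : ∀ C, ∑ g, L g C = if C = C0 then 1 else S := by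
    intro C
    by_cases hC : C = C0
    · simp [L, hC]
    · simp only [L, if_neg hC]
      rw [hS, Finset.sum_fiberwise]
  have h1 : ∑ g, ∑' C, rr s ^ cs C * L g C ≤ S :=
    Finset.sum_le_sum fun g _ => mu_ge hn hs hs2 g (L g) (hL g)
  rw [← Summable.tsum_finsetSum (fun _ _ => ENNReal.summable)] at h1
  simp_rw [← Finset.mul_sum, hsumL] at h1
  have hStop : S ≠ ⊤ := ne_top_of_le_ne_top ENNReal.one_ne_top (sum_mu_le hn hs hs2)
  have hr0 : rr s ≠ 0 := by
    rw [rr]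
    have : 0 < 1 / (s * (s + 2)) := by positivity
    simpa using this
  have hrtop : rr s ≠ ⊤ := by simp [rr]
  have h2 : ∑' C : Ctx n, rr s ^ cs C * (if C = C0 then 1 else S) + rr s ^ cs C0 * S =
      S + rr s ^ cs C0 := by
    have e : S = ∑' C : Ctx n, rr s ^ cs C * S := by
      rw [ENNReal.tsum_mul_right, tsum_pair_wl s hs hs2, one_mul]
    conv_rhs => rw [e]
    rw [← tsum_ite_eq C0 (fun C => rr s ^ cs C * S), ← ENNReal.tsum_add]
    rw [← tsum_ite_eq C0 (fun C => rr s ^ cs C), ← ENNReal.tsum_add]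
    congr 1; ext C
    by_cases hC : C = C0
    · simp [hC, add_comm]
    · simp [hC]
  have h3 : S + rr s ^ cs C0 ≤ S + rr s ^ cs C0 * S := by
    rw [← h2]; gcongr
  have h4 := (ENNReal.add_le_add_iff_left hStop).1 h3
  have hp0 : rr s ^ cs C0 ≠ 0 := pow_ne_zero _ hr0
  have hpt : rr s ^ cs C0 ≠ ⊤ := ENNReal.pow_ne_top hrtop
  rw [← mul_one (rr s ^ cs C0)] at h4
  rw [mul_assoc, one_mul] at h4
  exact (ENNReal.mul_le_mul_iff_right hp0 hpt).1 h4

lemma mu_eq (g : (Fin n → Bool) → Bool) :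
    mu g = ∑' C : Ctx n, rr s ^ cs C * ∑ h ∈ Finset.univ.filter (fun h => act C h = g), mu h := by
  have hle : ∀ g, ∑' C : Ctx n, rr s ^ cs C *
      ∑ h ∈ Finset.univ.filter (fun h => act C h = g), mu h ≤ mu g := fun g =>
    mu_ge hn hs hs2 g _ (fun C => sum_liminf_le hn hs hs2 _)
  have hsum : ∑ g, ∑' C : Ctx n, rr s ^ cs C *
      ∑ h ∈ Finset.univ.filter (fun h => act C h = g), mu h = 1 := by
    rw [← Summable.tsum_finsetSum (fun _ _ => ENNReal.summable)]
    simp_rw [← Finset.mul_sum, Finset.sum_fiberwise, sum_mu hn hs hs2]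
    simpa using tsum_pair_wl (n := n) s hs hs2
  refine le_antisymm ?_ (hle g)
  by_contra hlt
  rw [not_le] at hlt
  have h1 : ∑ g, ∑' C : Ctx n, rr s ^ cs C *
      ∑ h ∈ Finset.univ.filter (fun h => act C h = g), mu h < ∑ g, mu (n := n) g := by
    rw [← Finset.add_sum_erase _ _ (Finset.mem_univ g),
      ← Finset.add_sum_erase _ (fun g => mu g) (Finset.mem_univ g)]
    refine ENNReal.add_lt_add_of_lt_of_le ?_ hlt (Finset.sum_le_sum fun i _ => hle i)
    refine ne_top_of_le_ne_top ENNReal.one_ne_top ?_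
    rw [← hsum]
    exact Finset.sum_le_sum_of_subset (Finset.erase_subset _ _)
  rw [hsum, sum_mu hn hs hs2] at h1
  exact lt_irrefl _ h1

lemma mu_ne_top (g : (Fin n → Bool) → Bool) : mu g ≠ ⊤ := by
  refine ne_top_of_le_ne_top ENNReal.one_ne_top ?_
  rw [← sum_mu hn hs hs2]
  exact Finset.single_le_sum (f := fun g => mu g) (fun _ _ => zero_le) (Finset.mem_univ g)

lemma tendsto_rE (g : (Fin n → Bool) → Bool) :
    Tendsto (fun m => (rE m g).toReal) atTop (𝓝 (mu g).toReal) := by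
  have hrtop : ∀ᶠ m in atTop, ∀ g, rE (n := n) m g ≠ ⊤ := by
    filter_upwards [eventually_ge_atTop 3] with m hm g
    refine ne_top_of_le_ne_top ENNReal.one_ne_top ?_
    rw [← sum_rE hn hs hs2 m hm]
    exact Finset.single_le_sum (f := fun g => rE m g) (fun _ _ => zero_le) (Finset.mem_univ g)
  refine tendsto_of_liminf_sum (fun m g => (rE m g).toReal) (fun g => (mu g).toReal) ?_ ?_ ?_ g
  · filter_upwards [eventually_ge_atTop 3, hrtop] with m hm h
    rw [← ENNReal.toReal_sum (fun g _ => h g), sum_rE hn hs hs2 m hm]; simp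
  · rw [← ENNReal.toReal_sum (fun g _ => mu_ne_top hn hs hs2 g), sum_mu hn hs hs2]; simp
  · intro g a ha
    rcases lt_or_ge a 0 with h0 | h0
    · exact Eventually.of_forall fun m => h0.trans_le ENNReal.toReal_nonneg
    · have h1 : ENNReal.ofReal a < liminf (fun m => rE m g) atTop :=
        (ENNReal.ofReal_lt_iff_lt_toReal h0 (mu_ne_top hn hs hs2 g)).2 ha
      have h2 := Filter.eventually_lt_of_lt_liminf h1
      filter_upwards [h2, hrtop] with m hm h
      exact (ENNReal.ofReal_lt_iff_lt_toReal h0 (h g)).1 hm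

end

end NT

/-! ### Link with the proportions -/

namespace NT
open scoped ENNReal
open Filter Topology

lemma card_eq_tsum {α : Type*} (P : α → Prop) [DecidablePred P]
    (h : ∑' t : α, (if P t then (1 : ℝ≥0∞) else 0) ≠ ⊤) :
    Finite {t // P t} ∧ (Nat.card {t // P t} : ℝ) =
      (∑' t : α, (if P t then (1 : ℝ≥0∞) else 0)).toReal := by
  have e : ∑' t : α, (if P t then (1 : ℝ≥0∞) else 0) = ∑' _ : {t // P t}, 1 := by
    refine Eq.trans ?_ (tsum_subtype {t | P t} (fun _ => (1 : ℝ≥0∞))).symm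
    congr 1; ext t
    by_cases ht : P t <;> simp [ht, Set.indicator]
  rw [e] at h ⊢
  have hf : Finite {t // P t} := by
    by_contra hinf
    rw [not_finite_iff_infinite] at hinf
    exact h (ENNReal.tsum_const_eq_top_of_ne_zero one_ne_zero)
  refine ⟨hf, ?_⟩
  have := Fintype.ofFinite {t // P t}
  rw [tsum_fintype]
  simp

variable {n : ℕ}

lemma tendsto_Pmn (hn : 3 ≤ n) {s : ℝ} (hs : 0 < s) (hs2 : s ^ 2 = 2 * n)
    (f : (Fin n → Bool) → Bool) :
    Tendsto (fun m => Pmn n m f) atTop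
      (𝓝 (((mu f).toReal + (mu (fun x => !f x)).toReal) / 2)) := by
  have h1 := ((tendsto_rE hn hs hs2 f).add (tendsto_rE hn hs hs2 (fun x => !f x))).div_const 2
  refine Tendsto.congr' ?_ h1
  filter_upwards [eventually_ge_atTop 3] with m hm
  have hfin := card_eq_tsum (fun t : NT n => sz t = m) (lE_ne_top n m).2.1
  have hc : ∀ g : (Fin n → Bool) → Bool, (Nat.card {t : NT n // ev t = g ∧ sz t = m} : ℝ) =
      (cE g m).toReal := fun g => (card_eq_tsum (fun t : NT n => ev t = g ∧ sz t = m)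
        (ne_top_of_le_ne_top (lE_ne_top n m).2.1 (cE_le g m))).2
  have hA : (A n m : ℝ) = 2 * (aE n m).toReal := by
    rw [A, countIn_gen _ m (by omega) hfin.1]
    simp only [Set.mem_univ, true_and]
    push_cast
    rw [hfin.2, aE]; ring
  have hB : (countIn n {t | AT.eval t = f} m : ℝ) =
      (cE f m).toReal + (cE (fun x => !f x) m).toReal := by
    rw [countIn_gen _ m (by omega) hfin.1]
    push_cast
    rw [← hc, ← hc]
    have e1 : ∀ t : NT n, toAT t true ∈ {t | AT.eval t = f} ↔ ev t = f := by
      intro t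
      change AT.eval (toAT t true) = f ↔ _
      constructor
      · intro h; funext x; rw [← h, eval_toAT]; simp
      · intro h; funext x; rw [eval_toAT, h]; simp
    have e2 : ∀ t : NT n, toAT t false ∈ {t | AT.eval t = f} ↔ ev t = fun x => !f x := by
      intro t
      change AT.eval (toAT t false) = f ↔ _
      constructor
      · intro h; funext x; rw [← h, eval_toAT]; simp
      · intro h; funext x; rw [eval_toAT, h]; simp
    simp_rw [e1, e2]
  rw [Pmn, hA, hB, rE, rE, ENNReal.toReal_div, ENNReal.toReal_div]
  have : (aE n m).toReal ≠ 0 :=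
    (ENNReal.toReal_pos (aE_pos hn hs hs2 m hm) (lE_ne_top n m).2.1).ne'
  field_simp

end NT

/-! ### Killing contexts -/

namespace NT
open scoped ENNReal
open Filter Topology

variable {n : ℕ}

/-- lists whose conjunction of negations is identically false -/
def Kill (l : List (NT n)) : Prop := nor l = fun _ => false

/-- list of literals -/
def lits {k : ℕ} (f : Fin k → Fin n × Bool) : List (NT n) :=
  List.ofFn (fun a => leaf (f a).1 (f a).2)

lemma lits_length {k : ℕ} (f : Fin k → Fin n × Bool) : (lits f).length = k := by simp [lits]

lemma tot_lits {k : ℕ} (f : Fin k → Fin n × Bool) : tot (lits f) = k := by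
  simp [tot, lits, List.map_ofFn, List.sum_ofFn]

lemma lits_inj {k : ℕ} (f g : Fin k → Fin n × Bool) (h : lits f = lits g) : f = g := by
  have := List.ofFn_injective h
  funext a
  have := congrFun this a
  simp only [leaf.injEq] at this
  exact Prod.ext this.1 this.2

lemma kill_of {l : List (NT n)} (i : Fin n) (b : Bool) (h1 : leaf i b ∈ l) (h2 : leaf i (!b) ∈ l) :
    Kill l := by
  funext x
  rw [nor]
  by_contra h
  rw [Bool.not_eq_false, List.all_eq_true] at h
  have e1 := h _ h1
  have e2 := h _ h2
  simp only [ev_leaf] at e1 e2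
  revert e1 e2
  cases x i <;> cases b <;> simp

/-- set of negations of a family of literals -/
def negs {k : ℕ} (e : Fin k ↪ Fin n × Bool) : Finset (Fin n × Bool) :=
  Finset.univ.image (fun a => ((e a).1, !(e a).2))

lemma card_negs {k : ℕ} (e : Fin k ↪ Fin n × Bool) : (negs e).card = k := by
  rw [negs, Finset.card_image_of_injective]
  · simp
  · intro a b h
    apply e.injective
    simp only [Prod.mk.injEq, Bool.not_eq_eq_eq_not, Bool.not_not] at h
    exact Prod.ext h.1 h.2

/-- pairs of families of literals with complementary literals -/
abbrev WW (n k : ℕ) := Σ e : Fin k ↪ Fin n × Bool,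
  {g : Fin k → Fin n × Bool // ¬ ∀ a, g a ∉ negs e}

lemma card_WW (k : ℕ) (hk : k ≤ n) : (2 * n - k : ℝ) ^ k * ((2 * n) ^ k - (2 * n - k) ^ k) ≤
    (Fintype.card (WW n k) : ℝ) := by
  have hcL : Fintype.card (Fin n × Bool) = 2 * n := by simp [mul_comm]
  have h1 : ∀ e : Fin k ↪ Fin n × Bool,
      Fintype.card {g : Fin k → Fin n × Bool // ¬ ∀ a, g a ∉ negs e} =
        (2 * n) ^ k - (2 * n - k) ^ k := by
    intro e
    rw [Fintype.card_subtype_compl]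
    congr 1
    · rw [Fintype.card_fun, hcL, Fintype.card_fin]
    · have := Fintype.card_congr (Equiv.subtypePiEquivPi (α := Fin k) (β := fun _ => Fin n × Bool)
        (p := fun _ x => x ∉ negs e))
      rw [this, Fintype.card_fun, Fintype.card_fin, Fintype.card_subtype_compl, hcL]
      congr 2
      rw [Fintype.card_coe, card_negs]
  rw [Fintype.card_sigma, Finset.sum_congr rfl (fun e _ => h1 e), Finset.sum_const,
    Finset.card_univ, Fintype.card_embedding_eq, hcL, Fintype.card_fin, smul_eq_mul]
  have h2 := Nat.pow_sub_le_descFactorial (2 * n) k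
  have h3 : (2 * n - k) ^ k ≤ (2 * n + 1 - k) ^ k := Nat.pow_le_pow_left (by omega) k
  have h4 : (2 * n - k) ^ k ≤ (2 * n) ^ k := Nat.pow_le_pow_left (by omega) k
  have h5 : (2 * n - k : ℝ) = ((2 * n - k : ℕ) : ℝ) := by
    rw [Nat.cast_sub (by omega)]; push_cast; ring
  rw [Nat.cast_mul, Nat.cast_sub h4, h5]
  push_cast
  have h4' : (((2 * n - k : ℕ) : ℝ)) ^ k ≤ (2 * n) ^ k := by exact_mod_cast h4
  have h6 : (((2 * n - k : ℕ) : ℝ)) ^ k ≤ ((2 * n).descFactorial k : ℝ) := by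
    exact_mod_cast h3.trans h2
  exact mul_le_mul_of_nonneg_right h6 (by linarith)

/-- weight of killing contexts -/
noncomputable def kap (n : ℕ) (s : ℝ) : ℝ≥0∞ := by
  classical
  exact ∑' C : Ctx n, if Kill C.1.1 then rr s ^ cs C else 0

lemma not_kill_nil : ¬ Kill ([] : List (NT n)) := by
  intro h
  have := congrFun h (fun _ => false)
  simp [nor] at this

lemma wK_ge (r : ℝ≥0∞) (k : ℕ) [DecidablePred (Kill (n := n))] :
    (Fintype.card (WW n k) : ℝ≥0∞) * (r ^ (2 * k) * ∑' l : List (NT n), r ^ tot l) ≤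
      ∑' l : List (NT n), if Kill l then r ^ tot l else 0 := by
  let Φ : WW n k × List (NT n) → List (NT n) := fun p => lits p.1.1 ++ (lits p.1.2.1 ++ p.2)
  have hinj : Function.Injective Φ := by
    rintro ⟨⟨e, g, hg⟩, l⟩ ⟨⟨e', g', hg'⟩, l'⟩ h
    simp only [Φ] at h
    obtain ⟨h1, h2⟩ := List.append_inj h (by rw [lits_length, lits_length])
    obtain ⟨h2, h3⟩ := List.append_inj h2 (by rw [lits_length, lits_length])
    have h1 := DFunLike.coe_injective (lits_inj _ _ h1)
    have h2 := lits_inj _ _ h2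
    subst h1 h2 h3
    rfl
  refine le_trans (le_of_eq ?_) (ENNReal.tsum_comp_le_tsum_of_injective hinj _)
  have e : ∀ p : WW n k × List (NT n), (if Kill (Φ p) then r ^ tot (Φ p) else 0) =
      r ^ (2 * k) * r ^ tot p.2 := by
    rintro ⟨⟨e, g, hg⟩, l⟩
    rw [if_pos]
    · simp only [Φ, tot_append, tot_lits]
      rw [← pow_add]; congr 1; ring
    · push Not at hg
      obtain ⟨a, ha⟩ := hg
      simp only [negs, Finset.mem_image, Finset.mem_univ, true_and] at ha
      obtain ⟨b, hb⟩ := ha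
      refine kill_of (e b).1 (e b).2 ?_ ?_
      · simp only [Φ, lits, List.mem_append, List.mem_ofFn]
        exact Or.inl ⟨b, rfl⟩
      · simp only [Φ, lits, List.mem_append, List.mem_ofFn]
        exact Or.inr (Or.inl ⟨a, by rw [← hb]⟩)
  rw [tsum_congr e, ENNReal.tsum_prod']
  simp_rw [ENNReal.tsum_mul_left]
  rw [tsum_fintype (β := WW n k), Finset.sum_const, Finset.card_univ, nsmul_eq_mul]
  ring

lemma kap_ge (s : ℝ) (hs : 0 < s) (hs2 : s ^ 2 = 2 * n) (k : ℕ) :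
    (Fintype.card (WW n k) : ℝ≥0∞) * rr s ^ (2 * k) ≤ kap n s := by
  classical
  have h := tsum_ctx (n := n) (fun p => if Kill p.1 then
    rr s * (rr s ^ tot p.1 * rr s ^ tot p.2) else 0)
  simp only [not_kill_nil, if_false, zero_add] at h
  have e : kap n s = ∑' C : Ctx n, (if Kill C.1.1 then
    rr s * (rr s ^ tot C.1.1 * rr s ^ tot C.1.2) else 0) := by
    rw [kap]
    congr 1; ext C
    rw [cs, pow_add, pow_add, pow_one, mul_assoc]
  rw [e, ← h, ENNReal.tsum_prod']
  have e2 : ∀ a : List (NT n), ∑' b : List (NT n), (if Kill a then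
    rr s * (rr s ^ tot a * rr s ^ tot b) else 0) =
      (if Kill a then rr s ^ tot a else 0) * (rr s * ENNReal.ofReal (s + 1)) := by
    intro a
    split_ifs
    · rw [ENNReal.tsum_mul_left, ENNReal.tsum_mul_left, tsum_wl s hs hs2]; ring
    · simp
  rw [tsum_congr e2, ENNReal.tsum_mul_right]
  refine le_trans ?_ (mul_le_mul_left (wK_ge (rr s) k) _)
  rw [tsum_wl s hs hs2]
  have h2 : rr s * (ENNReal.ofReal (s + 1) * ENNReal.ofReal (s + 1)) = rr s + 1 := by
    rw [rr, ← ENNReal.ofReal_mul (by positivity), ← ENNReal.ofReal_mul (by positivity),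
      ← ENNReal.ofReal_one, ← ENNReal.ofReal_add (by positivity) (by positivity)]
    congr 1; field_simp; ring
  calc (Fintype.card (WW n k) : ℝ≥0∞) * rr s ^ (2 * k)
      ≤ (Fintype.card (WW n k) : ℝ≥0∞) * rr s ^ (2 * k) * (rr s + 1) := by
        refine le_mul_of_one_le_right zero_le ?_
        exact le_add_of_nonneg_left zero_le
    _ = _ := by rw [← h2]; ring

lemma kap_bound (hn : 1 ≤ n) (s : ℝ) (hs : 0 < s) (hs2 : s ^ 2 = 2 * n) :
    ENNReal.ofReal (Real.exp (-4) / 18) ≤ kap n s := by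
  set k := Nat.sqrt n with hk
  have hk1 : k * k ≤ n := Nat.sqrt_le n
  have hk2 : n < (k + 1) * (k + 1) := Nat.lt_succ_sqrt n
  have hk0 : 1 ≤ k := by
    by_contra h
    have : k = 0 := by omega
    rw [this] at hk2; omega
  have hkn : k ≤ n := le_trans (by nlinarith) hk1
  refine le_trans ?_ (kap_ge s hs hs2 k)
  have e : (Fintype.card (WW n k) : ℝ≥0∞) = ENNReal.ofReal (Fintype.card (WW n k) : ℝ) :=
    (ENNReal.ofReal_natCast _).symm
  rw [e, rr, ← ENNReal.ofReal_pow (by positivity), ← ENNReal.ofReal_mul (by positivity)]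
  apply ENNReal.ofReal_le_ofReal
  refine le_trans ?_ (mul_le_mul_of_nonneg_right (card_WW k hkn) (by positivity))
  have hnR : (1 : ℝ) ≤ n := by exact_mod_cast hn
  have hkR : (1 : ℝ) ≤ k := by exact_mod_cast hk0
  have hk1R : (k : ℝ) * k ≤ n := by exact_mod_cast hk1
  have hk2R : (n : ℝ) ≤ 4 * (k * k) := by
    have : n ≤ 4 * (k * k) := by nlinarith
    exact_mod_cast this
  set x : ℝ := k / (2 * n) with hx
  have hx0 : 0 ≤ x := by positivity
  have hkx : k * x = k * k / (2 * n) := by rw [hx]; ring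
  have hkx1 : k * x ≤ 1 / 2 := by rw [hkx, div_le_div_iff₀ (by positivity) (by norm_num)]; linarith
  have hkx2 : 1 / 8 ≤ k * x := by rw [hkx, div_le_div_iff₀ (by norm_num) (by positivity)]; linarith
  have hx1 : x ≤ 1 / 2 := le_trans (by nlinarith) hkx1
  have e1 : (2 * n - k : ℝ) = 2 * n * (1 - x) := by rw [hx]; field_simp
  have hA : 1 / 2 ≤ (1 - x) ^ k := by
    have := one_add_mul_le_pow (a := -x) (by linarith) k
    rw [← sub_eq_add_neg] at this
    linarith
  have hB : (1 - x) ^ k ≤ 8 / 9 := by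
    have h1 : (1 - x) ^ k ≤ Real.exp (-x) ^ k := by
      refine pow_le_pow_left₀ (by linarith) ?_ k
      have := Real.add_one_le_exp (-x); linarith
    rw [← Real.exp_nat_mul] at h1
    refine h1.trans ?_
    have h2 : (k : ℝ) * -x = -(k * x) := by ring
    rw [h2, Real.exp_neg]
    have h3 := Real.add_one_le_exp (k * x)
    rw [inv_le_comm₀ (Real.exp_pos _) (by norm_num)]
    norm_num; linarith
  have hks : (k : ℝ) ≤ s := by
    by_contra h
    push Not at h
    nlinarith
  have hC : Real.exp (-4) ≤ (s / (s + 2)) ^ (2 * k) := by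
    have h1 : (1 + 2 / s) ^ (2 * k) ≤ Real.exp 4 := by
      have h2 : (1 + 2 / s) ^ (2 * k) ≤ Real.exp (2 / s) ^ (2 * k) := by
        refine pow_le_pow_left₀ (by positivity) ?_ _
        have := Real.add_one_le_exp (2 / s); linarith
      rw [← Real.exp_nat_mul] at h2
      refine h2.trans (Real.exp_le_exp.2 ?_)
      push_cast
      rw [show 2 * (k : ℝ) * (2 / s) = 4 * k / s by ring, div_le_iff₀ hs]
      linarith
    have h3 : s / (s + 2) = (1 + 2 / s)⁻¹ := by field_simp
    rw [h3, inv_pow, Real.exp_neg]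
    exact inv_anti₀ (by positivity) h1
  have e2 : (2 * n - k : ℝ) ^ k * ((2 * n) ^ k - (2 * n - k) ^ k) * (1 / (s * (s + 2))) ^ (2 * k) =
      (s / (s + 2)) ^ (2 * k) * ((1 - x) ^ k * (1 - (1 - x) ^ k)) := by
    rw [e1, ← hs2]
    have : s / (s + 2) = s ^ 2 * (1 / (s * (s + 2))) := by field_simp
    rw [this, mul_pow, mul_pow, pow_mul (s ^ 2) 2 k, mul_comm 2 k, ]
    rw [show (s ^ 2) ^ 2 = s ^ 2 * s ^ 2 by ring, mul_pow]
    ring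
  rw [e2]
  have hE := Real.exp_pos (-4)
  calc Real.exp (-4) / 18 = Real.exp (-4) * (1 / 2 * (1 / 9)) := by ring
    _ ≤ _ := by
      refine mul_le_mul hC ?_ (by norm_num) (by positivity)
      exact mul_le_mul hA (by linarith) (by norm_num) (by linarith)

end NT

/-! ### Upper and lower bounds -/

namespace NT
open scoped ENNReal
open Filter Topology

lemma tsum_le_of_cover {α β : Type*} (R : β → α) (F : α → ℝ≥0∞) (G : β → ℝ≥0∞)
    (h : ∀ a, F a ≠ 0 → ∃ b, R b = a ∧ F a ≤ G b) : ∑' a, F a ≤ ∑' b, G b := by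
  classical
  have h1 : ∑' b, G b = ∑' a, ∑' b, (if a = R b then G b else 0) := by
    rw [ENNReal.tsum_comm]
    congr 1; ext b
    rw [tsum_ite_eq (R b) (fun _ => G b)]
  rw [h1]
  refine ENNReal.tsum_le_tsum fun a => ?_
  by_cases ha : F a = 0
  · rw [ha]; exact zero_le
  · obtain ⟨b, rfl, hb⟩ := h a ha
    refine hb.trans ?_
    refine le_trans (le_of_eq ?_) (ENNReal.le_tsum b)
    simp

variable {n : ℕ}

/-- dependence on the variable `i` -/
def dep (i : Fin n) (f : (Fin n → Bool) → Bool) : Prop :=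
  ∃ x v, f (Function.update x i v) ≠ f x

lemma not_dep {i : Fin n} {f : (Fin n → Bool) → Bool} (h : ¬ dep i f) (x v) :
    f (Function.update x i v) = f x := by
  by_contra h'
  exact h ⟨x, v, h'⟩

lemma nor_not_dep {i : Fin n} {l : List (NT n)} (h : ∀ t ∈ l, ¬ dep i (ev t)) (x v) :
    nor l (Function.update x i v) = nor l x := by
  rw [nor, nor, Bool.eq_iff_iff, List.all_eq_true, List.all_eq_true]
  exact forall₂_congr fun t ht => by rw [not_dep (h t ht)]

open Classical in
/-- weight of trees depending on `i` -/
noncomputable def DD (i : Fin n) (r : ℝ≥0∞) : ℝ≥0∞ :=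
  ∑' t : NT n, if dep i (ev t) then r ^ sz t else 0

lemma dep_leaf {i j : Fin n} {b : Bool} (h : dep i (ev (leaf j b))) : j = i := by
  obtain ⟨x, v, h⟩ := h
  by_contra hne
  simp [Function.update_of_ne hne] at h

lemma plug_of_mem (l : List (NT n)) (h : 2 ≤ l.length) (t : NT n) (ht : t ∈ l) :
    ∃ C : Ctx n, plug C t = mk l h := by
  obtain ⟨l1, l2, rfl⟩ := List.append_of_mem ht
  refine ⟨⟨(l1, l2), ?_⟩, rfl⟩
  intro e
  simp only [Prod.mk.injEq] at e
  rw [e.1, e.2] at h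
  simp at h

open Classical in
lemma DD_le (i : Fin n) (r : ℝ≥0∞) : DD i r ≤ 2 * r +
    (∑' C : Ctx n, if ¬ Kill C.1.1 then r ^ cs C else 0) * DD i r := by
  have hlf : ∑ p : Fin n × Bool, (if dep i (ev (leaf p.1 p.2)) then r ^ sz (leaf p.1 p.2) else 0)
      ≤ 2 * r := by
    calc _ ≤ ∑ p : Fin n × Bool, (if p.1 = i then r else 0) := by
          refine Finset.sum_le_sum fun p _ => ?_
          split_ifs with h1 h2 h2
          · simp
          · exact absurd (dep_leaf h1) h2
          · exact zero_le
          · exact le_rfl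
      _ = 2 * r := by
          rw [Fintype.sum_prod_type]
          simp [two_mul, Finset.sum_add_distrib]
  have hnd : ∑' l : {l : List (NT n) // 2 ≤ l.length},
      (if dep i (ev (mk l.1 l.2)) then r ^ sz (mk l.1 l.2) else 0) ≤
      (∑' C : Ctx n, if ¬ Kill C.1.1 then r ^ cs C else 0) * DD i r := by
    let G : Ctx n × NT n → ℝ≥0∞ := fun p =>
      (if ¬ Kill p.1.1.1 then r ^ cs p.1 else 0) * (if dep i (ev p.2) then r ^ sz p.2 else 0)
    have hG : ∑' p, G p = (∑' C : Ctx n, if ¬ Kill C.1.1 then r ^ cs C else 0) * DD i r := by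
      rw [ENNReal.tsum_prod']
      simp only [G]
      simp_rw [ENNReal.tsum_mul_left, ENNReal.tsum_mul_right]
      rfl
    rw [← hG]
    let F : NT n → ℝ≥0∞ := fun t => if (∃ l h, t = mk l h) ∧ dep i (ev t) then r ^ sz t else 0
    have hF : ∑' l : {l : List (NT n) // 2 ≤ l.length},
      (if dep i (ev (mk l.1 l.2)) then r ^ sz (mk l.1 l.2) else 0) ≤ ∑' t, F t := by
      rw [tsum_NT]
      refine le_trans (le_of_eq ?_) le_add_self
      congr 1; ext l
      have : ∃ l' h, mk l.1 l.2 = mk l' h := ⟨l.1, l.2, rfl⟩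
      simp only [F, this, true_and]
    refine hF.trans (tsum_le_of_cover (fun p : Ctx n × NT n => plug p.1 p.2) F G ?_)
    intro t ht
    have ht' : (∃ l h, t = mk l h) ∧ dep i (ev t) := by
      by_contra hc
      exact ht (if_neg hc)
    obtain ⟨⟨l, h, rfl⟩, hd⟩ := ht'
    have hex : ∃ u ∈ l, dep i (ev u) := by
      by_contra hc
      push Not at hc
      obtain ⟨x, v, hx⟩ := hd
      rw [ev_mk] at hx
      exact hx (nor_not_dep hc x v)
    obtain ⟨u, hu, hud⟩ := hex
    obtain ⟨C, hC⟩ := plug_of_mem l h u hu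
    refine ⟨(C, u), hC, ?_⟩
    rw [← hC] at hd ⊢
    have hk : ¬ Kill C.1.1 := by
      intro hk
      obtain ⟨x, v, hx⟩ := hd
      have hk' : ∀ y, nor C.1.1 y = false := fun y => congrFun hk y
      rw [ev_plug] at hx
      simp [act, hk'] at hx
    simp only [F, G, if_pos hk, if_pos hud, sz_plug]
    rw [← pow_add]
    split_ifs
    · exact le_rfl
    · exact zero_le
  calc DD i r = _ := tsum_NT _
    _ ≤ _ := add_le_add hlf hnd

lemma DD_bound (i : Fin n) (s : ℝ) (hs : 0 < s) (hs2 : s ^ 2 = 2 * n) :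
    kap n s * DD i (rr s) ≤ 2 * rr s := by
  classical
  have h1 := DD_le i (rr s)
  set D := DD i (rr s) with hD
  set k' : ℝ≥0∞ := ∑' C : Ctx n, if ¬ Kill C.1.1 then rr s ^ cs C else 0 with hk'
  have hDt : D ≠ ⊤ := by
    refine ne_top_of_le_ne_top ENNReal.ofReal_ne_top (b := ENNReal.ofReal (s / (s + 1))) ?_
    rw [← tau_val s hs hs2, hD, DD]
    refine ENNReal.tsum_le_tsum fun t => ?_
    split_ifs
    · exact le_rfl
    · exact zero_le
  have hsum : kap n s + k' = 1 := by
    rw [← tsum_pair_wl (n := n) s hs hs2, kap, hk', ← ENNReal.tsum_add]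
    congr 1; ext C
    by_cases h : Kill C.1.1 <;> simp [h]
  have hk1 : k' ≠ ⊤ := ne_top_of_le_ne_top ENNReal.one_ne_top (by rw [← hsum]; exact le_add_self)
  have h2 : kap n s * D + k' * D ≤ 2 * rr s + k' * D := by
    rw [← add_mul, hsum, one_mul]; exact h1
  exact (ENNReal.add_le_add_iff_right (ENNReal.mul_ne_top hk1 hDt)).1 h2

/-- trees that vanish when `x i = b` -/
def good (i : Fin n) (b : Bool) (t : NT n) : Prop := ∀ x, x i = b → ev t x = false

open Classical in
/-- weight of good trees -/
noncomputable def gw (i : Fin n) (b : Bool) (r : ℝ≥0∞) (t : NT n) : ℝ≥0∞ :=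
  if good i b t then r ^ sz t else 0

lemma good_leaf {i j : Fin n} {b c : Bool} (h : good i b (leaf j c)) : j = i ∧ c = !b := by
  have hj : j = i := by
    by_contra hne
    have := h (Function.update (fun _ => c) i b) (by simp)
    simp [Function.update_of_ne hne] at this
  subst hj
  have := h (fun _ => b) rfl
  refine ⟨rfl, ?_⟩
  revert this
  cases b <;> cases c <;> simp

lemma gw_sum (i : Fin n) (b : Bool) (s : ℝ) (hs : 4 ≤ s) (hs2 : s ^ 2 = 2 * n) :
    ∑' t, gw i b (rr s) t ≤ ENNReal.ofReal (1 / 2) := by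
  classical
  have hs0 : 0 < s := by linarith
  rw [tsum_NT]
  have h1 : ∑ p : Fin n × Bool, gw i b (rr s) (leaf p.1 p.2) ≤ rr s := by
    calc _ ≤ ∑ p : Fin n × Bool, (if p = (i, !b) then rr s else 0) := by
          refine Finset.sum_le_sum fun p _ => ?_
          rw [gw]
          split_ifs with h1 h2 h2
          · simp
          · exact absurd (Prod.ext (good_leaf h1).1 (good_leaf h1).2) h2
          · exact zero_le
          · exact le_rfl
      _ = rr s := by simp
  have h2 : ∑' l : {l : List (NT n) // 2 ≤ l.length}, gw i b (rr s) (mk l.1 l.2) ≤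
      ENNReal.ofReal (s / ((s + 1) * (s + 2))) := by
    have e1 : (1 : ℝ≥0∞) - ENNReal.ofReal (s / (s + 1)) = ENNReal.ofReal (1 / (s + 1)) := by
      rw [← ENNReal.ofReal_one, ← ENNReal.ofReal_sub _ (by positivity)]
      congr 1; field_simp; ring
    have e2 : ENNReal.ofReal (s / ((s + 1) * (s + 2))) =
        rr s * ∑' l : {l : List (NT n) // 2 ≤ l.length}, (l.1.map (fun t => rr s ^ sz t)).prod := by
      rw [tsum_list_ge_two, tau_val s hs0 hs2, e1, ← ENNReal.ofReal_inv_of_pos (by positivity),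
        rr, ← ENNReal.ofReal_pow (by positivity),
        ← ENNReal.ofReal_mul (by positivity), ← ENNReal.ofReal_mul (by positivity)]
      congr 1; field_simp
    rw [e2, ← ENNReal.tsum_mul_left]
    refine ENNReal.tsum_le_tsum fun l => ?_
    rw [gw, sz_mk, ← pow_tot, pow_add, pow_one]
    split_ifs
    · exact le_rfl
    · exact zero_le
  refine (add_le_add h1 h2).trans ?_
  rw [rr, ← ENNReal.ofReal_add (by positivity) (by positivity)]
  apply ENNReal.ofReal_le_ofReal
  have : 1 / (s * (s + 2)) + s / ((s + 1) * (s + 2)) = (s ^ 2 + s + 1) / (s * (s + 1) * (s + 2)) := by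
    field_simp; ring
  rw [this, div_le_div_iff₀ (by positivity) (by norm_num)]
  nlinarith [mul_nonneg hs0.le hs0.le, mul_nonneg (sub_nonneg.2 hs) (mul_nonneg hs0.le hs0.le)]

/-- weight of lists of good trees -/
noncomputable def gl (i : Fin n) (b : Bool) (r : ℝ≥0∞) (l : List (NT n)) : ℝ≥0∞ :=
  (l.map (gw i b r)).prod

lemma gl_sum (i : Fin n) (b : Bool) (s : ℝ) (hs : 4 ≤ s) (hs2 : s ^ 2 = 2 * n) :
    ∑' l, gl i b (rr s) l ≤ 2 := by
  simp only [gl]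
  rw [tsum_list_prod, ENNReal.inv_le_iff_inv_le]
  have h := gw_sum i b s hs hs2
  refine le_trans ?_ (tsub_le_tsub_left h 1)
  rw [← ENNReal.ofReal_one, ← ENNReal.ofReal_sub _ (by norm_num),
    show (2 : ℝ≥0∞) = ENNReal.ofReal 2 by simp, ← ENNReal.ofReal_inv_of_pos (by norm_num)]
  apply ENNReal.ofReal_le_ofReal
  norm_num

lemma gl_of_good {i : Fin n} {b : Bool} {r : ℝ≥0∞} {l : List (NT n)} (h : ∀ t ∈ l, good i b t) :
    gl i b r l = r ^ tot l := by
  rw [gl, pow_tot]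
  congr 1
  apply List.map_congr_left
  intro t ht
  rw [gw, if_pos (h t ht)]

open Classical in
/-- lists of good trees with a dependent tree -/
noncomputable def gd (i : Fin n) (b : Bool) (r : ℝ≥0∞) (l : List (NT n)) : ℝ≥0∞ :=
  if (∀ t ∈ l, good i b t) ∧ ∃ t ∈ l, dep i (ev t) then r ^ tot l else 0

lemma gd_sum (i : Fin n) (b : Bool) (s : ℝ) (hs : 4 ≤ s) (hs2 : s ^ 2 = 2 * n) :
    ∑' l, gd i b (rr s) l ≤ 4 * DD i (rr s) := by
  classical
  let G : List (NT n) × (NT n × List (NT n)) → ℝ≥0∞ := fun p =>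
    gl i b (rr s) p.1 * ((if dep i (ev p.2.1) then rr s ^ sz p.2.1 else 0) * gl i b (rr s) p.2.2)
  have h1 : ∑' l, gd i b (rr s) l ≤ ∑' p, G p := by
    refine tsum_le_of_cover (fun p => p.1 ++ p.2.1 :: p.2.2) _ G ?_
    intro l hl
    have hl' : (∀ t ∈ l, good i b t) ∧ ∃ t ∈ l, dep i (ev t) := by
      by_contra hc
      exact hl (if_neg hc)
    obtain ⟨hg, t, ht, hd⟩ := hl'
    obtain ⟨l1, l2, rfl⟩ := List.append_of_mem ht
    refine ⟨(l1, t, l2), rfl, ?_⟩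
    simp only [G, gd]
    rw [if_pos hd, gl_of_good (fun u hu => hg u (by simp [hu])),
      gl_of_good (fun u hu => hg u (by simp [hu]))]
    split_ifs
    · rw [tot_append, tot_cons, pow_add, pow_add]
    · exact zero_le
  refine h1.trans ?_
  rw [ENNReal.tsum_prod']
  simp only [G]
  simp_rw [ENNReal.tsum_mul_left, ENNReal.tsum_mul_right]
  rw [ENNReal.tsum_prod' ]
  simp_rw [ENNReal.tsum_mul_left, ENNReal.tsum_mul_right]
  have h2 := gl_sum i b s hs hs2
  calc _ ≤ 2 * (DD i (rr s) * 2) := mul_le_mul' h2 (mul_le_mul' le_rfl h2)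
    _ = 4 * DD i (rr s) := by ring

section
variable (hn : 3 ≤ n) {s : ℝ} (hs : 4 ≤ s) (hs2 : s ^ 2 = 2 * n)
include hn hs hs2

lemma mu_lit_le (i : Fin n) (b : Bool) : mu (fun x : Fin n → Bool => x i == b) ≤
    4 * rr s * mu (fun x : Fin n → Bool => x i == !b) + 16 * rr s * DD i (rr s) := by
  classical
  have hs0 : 0 < s := by linarith
  set g : (Fin n → Bool) → Bool := fun x => x i == b with hg
  set g' : (Fin n → Bool) → Bool := fun x => x i == !b with hg'
  set r := rr s with hr
  let T : List (NT n) × List (NT n) → ℝ≥0∞ := fun p =>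
    r * (gl i b r p.1 * gl i b r p.2) * mu g' +
      r * (gd i b r p.1 * gl i b r p.2 + gl i b r p.1 * gd i b r p.2)
  have key : ∀ C : Ctx n, r ^ cs C * ∑ h ∈ Finset.univ.filter (fun h => act C h = g), mu h ≤
      T C.1 := by
    intro C
    by_cases hne : ∃ h, act C h = g
    · obtain ⟨h0, hh0⟩ := hne
      have hnor : ∀ x, x i = b → nor C.1.1 x = true ∧ nor C.1.2 x = true := by
        intro x hx
        have := congrFun hh0 x
        simp only [act, hg, hx, beq_self_eq_true, Bool.and_eq_true] at this
        exact this.1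
      have hg1 : ∀ t ∈ C.1.1, good i b t := by
        intro t ht x hx
        have := (hnor x hx).1
        rw [nor, List.all_eq_true] at this
        simpa using this t ht
      have hg2 : ∀ t ∈ C.1.2, good i b t := by
        intro t ht x hx
        have := (hnor x hx).2
        rw [nor, List.all_eq_true] at this
        simpa using this t ht
      have hcs : r ^ cs C = r * (r ^ tot C.1.1 * r ^ tot C.1.2) := by
        rw [cs, pow_add, pow_add, pow_one, mul_assoc]
      by_cases hd : (∃ t ∈ C.1.1, dep i (ev t)) ∨ (∃ t ∈ C.1.2, dep i (ev t))
      · have hle : ∑ h ∈ Finset.univ.filter (fun h => act C h = g), mu h ≤ 1 := by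
          rw [← sum_mu hn hs0 hs2]
          exact Finset.sum_le_sum_of_subset (Finset.filter_subset _ _)
        refine (mul_le_mul_right hle _).trans ?_
        rw [mul_one, hcs]
        refine le_trans ?_ le_add_self
        refine mul_le_mul_right ?_ _
        rw [gl_of_good hg1, gl_of_good hg2]
        rcases hd with hd | hd
        · refine le_trans (le_of_eq ?_) le_self_add
          rw [gd, if_pos ⟨hg1, hd⟩]
        · refine le_trans (le_of_eq ?_) le_add_self
          rw [gd, if_pos ⟨hg2, hd⟩]
      · push Not at hd
        have hsub : Finset.univ.filter (fun h => act C h = g) ⊆ {g'} := by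
          intro h hh
          rw [Finset.mem_filter] at hh
          rw [Finset.mem_singleton]
          funext x
          have hx := congrFun hh.2 x
          have h1 := hnor (Function.update x i b) (by simp)
          rw [nor_not_dep hd.1, nor_not_dep hd.2] at h1
          simp only [act, h1.1, h1.2, hg, Bool.true_and] at hx
          simp only [hg']
          revert hx
          cases h x <;> cases x i <;> cases b <;> simp
        have hle : ∑ h ∈ Finset.univ.filter (fun h => act C h = g), mu h ≤ mu g' := by
          refine (Finset.sum_le_sum_of_subset hsub).trans ?_
          simp
        refine (mul_le_mul_right hle _).trans ?_
        refine le_trans (le_of_eq ?_) le_self_add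
        rw [hcs, gl_of_good hg1, gl_of_good hg2]
    · rw [Finset.filter_false_of_mem]
      · simp
      · intro h _ hh
        exact hne ⟨h, hh⟩
  have hgl := gl_sum i b s hs hs2
  have hgd := gd_sum i b s hs hs2
  rw [← hr] at hgl hgd
  have hT : ∑' p, T p ≤ 4 * r * mu g' + 16 * r * DD i r := by
    rw [ENNReal.tsum_prod']
    simp only [T]
    simp only [ENNReal.tsum_add, ENNReal.tsum_mul_left, ENNReal.tsum_mul_right]
    refine add_le_add ?_ ?_
    · calc _ ≤ r * (2 * 2) * mu g' := by gcongr
        _ = _ := by ring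
    · calc _ ≤ r * (4 * DD i r * 2 + 2 * (4 * DD i r)) := by gcongr
        _ = _ := by ring
  rw [mu_eq hn hs0 hs2 g]
  refine (ENNReal.tsum_le_tsum key).trans (le_trans ?_ hT)
  rw [tsum_ctx T]
  exact le_add_self

lemma mu_lit_ge (i : Fin n) (b : Bool) :
    rr s ^ 2 * kap n s ≤ mu (fun x : Fin n → Bool => x i == b) := by
  classical
  have hs0 : 0 < s := by linarith
  have h1 : kap n s ≤ mu (fun _ : Fin n → Bool => false) := by
    rw [mu_eq hn hs0 hs2, kap]
    refine ENNReal.tsum_le_tsum fun C => ?_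
    split_ifs with hk
    · rw [Finset.filter_true_of_mem, sum_mu hn hs0 hs2, mul_one]
      intro h _
      funext x
      have : nor C.1.1 x = false := congrFun hk x
      simp [act, this]
    · exact zero_le
  let C1 : Ctx n := ⟨([leaf i (!b)], []), by simp⟩
  have hcs : cs C1 = 2 := by simp [cs, C1]
  have hact : act C1 (fun _ => false) = fun x : Fin n → Bool => x i == b := by
    funext x
    simp only [act, nor, C1, List.all_cons, List.all_nil, ev_leaf]
    cases x i <;> cases b <;> rfl
  rw [mu_eq hn hs0 hs2 (fun x : Fin n → Bool => x i == b)]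
  refine le_trans ?_ (ENNReal.le_tsum C1)
  rw [hcs]
  refine mul_le_mul_right (h1.trans ?_) _
  exact Finset.single_le_sum (f := fun h => mu h) (fun _ _ => zero_le) (by simp [hact])

end

end NT

namespace NT
open scoped ENNReal
open Filter Topology

variable {n : ℕ}

lemma final_bounds (hn : 8 ≤ n) {s : ℝ} (hs0 : 0 < s) (hs2 : s ^ 2 = 2 * n) (i : Fin n) :
    (Real.exp (-4) / 18 / 16) / (n : ℝ) ^ 2 ≤
      ((mu (fun x : Fin n → Bool => x i == true)).toReal +
        (mu (fun x : Fin n → Bool => x i == false)).toReal) / 2 ∧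
    ((mu (fun x : Fin n → Bool => x i == true)).toReal +
        (mu (fun x : Fin n → Bool => x i == false)).toReal) / 2 ≤
      (16 / (Real.exp (-4) / 18)) / (n : ℝ) ^ 2 := by
  have hnR : (8 : ℝ) ≤ n := by exact_mod_cast hn
  have hs : 4 ≤ s := by nlinarith
  have hn3 : 3 ≤ n := by omega
  have hδ : 0 < Real.exp (-4) / 18 := by have := Real.exp_pos (-4); positivity
  set δ := Real.exp (-4) / 18 with hδd
  set R : ℝ := 1 / (s * (s + 2)) with hR
  have hR0 : 0 < R := by positivity
  have hrR : (rr s).toReal = R := by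
    rw [rr, ENNReal.toReal_ofReal (by positivity)]
  have hrt : rr s ≠ ⊤ := by simp [rr]
  have hkap1 : kap n s ≤ 1 := by
    classical
    rw [← tsum_pair_wl (n := n) s hs0 hs2, kap]
    refine ENNReal.tsum_le_tsum fun C => ?_
    split_ifs
    · exact le_rfl
    · exact zero_le
  have hkt : kap n s ≠ ⊤ := ne_top_of_le_ne_top ENNReal.one_ne_top hkap1
  have hk : δ ≤ (kap n s).toReal :=
    (ENNReal.ofReal_le_iff_le_toReal hkt).1 (kap_bound (by omega) s hs0 hs2)
  set k := (kap n s).toReal with hkd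
  have hDt : DD i (rr s) ≠ ⊤ := by
    classical
    refine ne_top_of_le_ne_top ENNReal.ofReal_ne_top (b := ENNReal.ofReal (s / (s + 1))) ?_
    rw [← tau_val s hs0 hs2, DD]
    refine ENNReal.tsum_le_tsum fun t => ?_
    split_ifs
    · exact le_rfl
    · exact zero_le
  have hkD : k * (DD i (rr s)).toReal ≤ 2 * R := by
    have := ENNReal.toReal_mono (ENNReal.mul_ne_top (by simp) hrt) (DD_bound i s hs0 hs2)
    rwa [ENNReal.toReal_mul, ENNReal.toReal_mul, hrR] at this
  set D := (DD i (rr s)).toReal with hDd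
  have hD0 : 0 ≤ D := ENNReal.toReal_nonneg
  have hup : ∀ b : Bool, (mu (fun x : Fin n → Bool => x i == b)).toReal ≤
      4 * R * (mu (fun x : Fin n → Bool => x i == !b)).toReal + 16 * R * D := by
    intro b
    have hmt := mu_ne_top hn3 hs0 hs2 (fun x : Fin n → Bool => x i == !b)
    have t1 : 4 * rr s * mu (fun x : Fin n → Bool => x i == !b) ≠ ⊤ :=
      ENNReal.mul_ne_top (ENNReal.mul_ne_top (by simp) hrt) hmt
    have t2 : 16 * rr s * DD i (rr s) ≠ ⊤ :=
      ENNReal.mul_ne_top (ENNReal.mul_ne_top (by simp) hrt) hDt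
    have := ENNReal.toReal_mono (ENNReal.add_ne_top.2 ⟨t1, t2⟩) (mu_lit_le hn3 hs hs2 i b)
    rw [ENNReal.toReal_add t1 t2, ENNReal.toReal_mul, ENNReal.toReal_mul, ENNReal.toReal_mul,
      ENNReal.toReal_mul, hrR] at this
    exact this
  have hlow : ∀ b : Bool, R ^ 2 * k ≤ (mu (fun x : Fin n → Bool => x i == b)).toReal := by
    intro b
    have := ENNReal.toReal_mono (mu_ne_top hn3 hs0 hs2 _) (mu_lit_ge hn3 hs hs2 i b)
    rwa [ENNReal.toReal_mul, ENNReal.toReal_pow, hrR] at this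
  have u1 := hup true
  have u2 := hup false
  have l1 := hlow true
  have l2 := hlow false
  simp only [Bool.not_true, Bool.not_false] at u1 u2
  set a := (mu (fun x : Fin n → Bool => x i == true)).toReal
  set a' := (mu (fun x : Fin n → Bool => x i == false)).toReal
  have ha0 : 0 ≤ a := ENNReal.toReal_nonneg
  have ha0' : 0 ≤ a' := ENNReal.toReal_nonneg
  have hRup : R ≤ 1 / (2 * n) := by
    rw [hR, ← hs2]
    apply one_div_le_one_div_of_le (by positivity)
    nlinarith
  have hRlow : 1 / (4 * n) ≤ R := by
    rw [hR]
    apply one_div_le_one_div_of_le (by positivity)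
    nlinarith
  have hR16 : R ≤ 1 / 16 := by
    refine hRup.trans (one_div_le_one_div_of_le (by norm_num) (by linarith))
  clear_value a a' D k R δ
  have hn0 : (0 : ℝ) < n := by linarith
  constructor
  · have h1 : δ / 16 / (n : ℝ) ^ 2 = (1 / (4 * n)) ^ 2 * δ := by field_simp; norm_num
    rw [h1]
    have h2 : (1 / (4 * n : ℝ)) ^ 2 * δ ≤ R ^ 2 * k := by gcongr
    linarith
  · have h1 : a + a' ≤ 64 * R * D := by
      have : 4 * R * (a + a') ≤ 1 / 4 * (a + a') := by
        apply mul_le_mul_of_nonneg_right _ (by positivity); linarith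
      have hRD : 0 ≤ R * D := by positivity
      nlinarith
    have h2 : δ * D ≤ 2 * R := (mul_le_mul_of_nonneg_right hk hD0).trans hkD
    have h3 : D ≤ 2 * R / δ := by rw [le_div_iff₀ hδ]; linarith
    have h4 : (a + a') / 2 ≤ 64 * R ^ 2 / δ := by
      calc (a + a') / 2 ≤ 32 * R * D := by linarith
        _ ≤ 32 * R * (2 * R / δ) := by gcongr
        _ = 64 * R ^ 2 / δ := by ring
    refine h4.trans ?_
    have h5 : R ^ 2 ≤ (1 / (2 * n : ℝ)) ^ 2 := pow_le_pow_left₀ hR0.le hRup 2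
    calc 64 * R ^ 2 / δ ≤ 64 * (1 / (2 * n : ℝ)) ^ 2 / δ :=
          div_le_div_of_nonneg_right (by linarith) hδ.le
      _ = 16 / δ / (n : ℝ) ^ 2 := by field_simp; norm_num

end NT

/-- For a fixed `i ≥ 1`, letting `f` be the literal function `x ↦ x_i` on `n ≥ i`
variables, `P_n(f) = Θ(1/n²)` as `n → ∞`. -/
theorem statement2 (i : ℕ) (hi : 1 ≤ i) :
    ∃ c₁ c₂ : ℝ, 0 < c₁ ∧ c₁ ≤ c₂ ∧ ∃ N : ℕ,
      ∀ n : ℕ, N ≤ n → ∀ hin : i ≤ n,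
        ∃ p : ℝ,
          Filter.Tendsto (fun m => Pmn n m (fun x => x ⟨i - 1, by omega⟩))
            Filter.atTop (nhds p) ∧
          c₁ / (n : ℝ) ^ 2 ≤ p ∧ p ≤ c₂ / (n : ℝ) ^ 2 := by
  have hE := Real.exp_pos (-4)
  have hE1 : Real.exp (-4) ≤ 1 := by rw [Real.exp_le_one_iff]; norm_num
  refine ⟨Real.exp (-4) / 18 / 16, 16 / (Real.exp (-4) / 18), by positivity, ?_, 8, ?_⟩
  · have h1 : Real.exp (-4) / 18 / 16 ≤ 1 := by
      rw [div_div, div_le_one (by norm_num)]; linarith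
    refine h1.trans ?_
    rw [le_div_iff₀ (by positivity)]; linarith
  intro n hn hin
  have hnR : (8 : ℝ) ≤ n := by exact_mod_cast hn
  have hs0 : 0 < Real.sqrt (2 * n) := Real.sqrt_pos.2 (by linarith)
  have hs2 : Real.sqrt (2 * n) ^ 2 = 2 * n := Real.sq_sqrt (by linarith)
  have hlim := NT.tendsto_Pmn (n := n) (by omega) hs0 hs2 (fun x => x ⟨i - 1, by omega⟩)
  have hb := NT.final_bounds hn hs0 hs2 ⟨i - 1, by omega⟩
  simp only [beq_true, beq_false] at hb
  exact ⟨_, hlim, hb⟩
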